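/- Let T be a colimit-preserving monad on a Grothendieck abelian category K and C a deconstructible class of objects of K. Then the class of T-algebras A such that UA ∈ C (U the forgetful functor) is deconstructible in the category Alg(T) of T-algebras, where Alg(T) is again Grothendieck abelian. -/

import Mathlib

open CategoryTheory Category Limits Opposite

universe w v u u' u''

namespace CellularPaper

variable {K : Type u} [Category.{v} K]

/-- The restriction of a chain `F : J ⥤ K` to the elements below `j`. -/
def restrictionLT {J : Type w} [Preorder J] (F : J ⥤ K) (j : J) :
    {i : J // i < j} ⥤ K :=
  (Monotone.functor (f := fun i : {i : J // i < j} => (i : J)) fun _ _ h => h) ⋙ F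

/-- The cocone on the restriction of `F` below `j` with apex `F.obj j`. -/
@[simps]
def coconeLT {J : Type w} [Preorder J] (F : J ⥤ K) (j : J) :
    Cocone (restrictionLT F j) where
  pt := F.obj j
  ι :=
    { app := fun i => F.map (homOfLE i.2.le)
      naturality := fun i i' h => by
        dsimp [restrictionLT, Monotone.functor]
        rw [← F.map_comp]
        simp }

/-- `f` is a transfinite composite of a smooth chain with links in `C`. -/
def IsTransfiniteCompositionOf (C : MorphismProperty K) : MorphismProperty K :=
  fun A B f =>
    ∃ (J : Type w) (_ : LinearOrder J) (_ : SuccOrder J) (_ : OrderBot J)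
      (_ : WellFoundedLT J) (F : J ⥤ K) (c : Cocone F) (_ : IsColimit c)
      (eA : A ≅ F.obj ⊥) (eB : c.pt ≅ B),
      (∀ j : J, ¬IsMax j → C (F.map (homOfLE (Order.le_succ j)))) ∧
      (∀ j : J, Order.IsSuccLimit j → Nonempty (IsColimit (coconeLT F j))) ∧
      eA.hom ≫ c.ι.app ⊥ ≫ eB.hom = f

/-- A cellular structure: a class of morphisms containing all isomorphisms and closed
under pushout and transfinite composition. -/
structure IsCellular (C : MorphismProperty K) : Prop where
  isos : ∀ {A B : K} (f : A ⟶ B), IsIso f → C f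
  pushout : ∀ {A B A' B' : K} {f : A ⟶ B} {u : A ⟶ A'} {v : B ⟶ B'} {g : A' ⟶ B'},
    IsPushout f u v g → C f → C g
  transfinite : ∀ {A B : K} (f : A ⟶ B), IsTransfiniteCompositionOf.{v} C f → C f

/-- `f` is a retract of `g` in the arrow category. -/
def IsRetractOf {A B X Y : K} (f : A ⟶ B) (g : X ⟶ Y) : Prop :=
  ∃ (u : A ⟶ X) (v : B ⟶ Y) (r : X ⟶ A) (s : Y ⟶ B),
    u ≫ g = f ≫ v ∧ r ≫ f = g ≫ s ∧ u ≫ r = 𝟙 A ∧ v ≫ s = 𝟙 B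

/-- The class of retracts of morphisms in `C`. -/
def retracts (C : MorphismProperty K) : MorphismProperty K :=
  fun _ _ f => ∃ (X Y : K) (g : X ⟶ Y), C g ∧ IsRetractOf f g

/-- The class of pushouts of morphisms in `C`. -/
def Po (C : MorphismProperty K) : MorphismProperty K :=
  fun A' B' g => ∃ (A B : K) (f : A ⟶ B) (u : A ⟶ A') (v : B ⟶ B'),
    C f ∧ IsPushout f u v g

/-- A κ-directed preorder. -/
def IsCardinalDirected (P : Type v) [Preorder P] (κ : Cardinal.{v}) : Prop :=
  ∀ S : Set P, Cardinal.mk S < κ → ∃ p : P, ∀ s ∈ S, s ≤ p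

/-- A κ-presentable object: its hom-functor preserves κ-directed colimits. -/
def IsCardinalPresentable (κ : Cardinal.{v}) (A : K) : Prop :=
  ∀ (P : Type v) (_ : Preorder P), IsCardinalDirected P κ →
    Nonempty (PreservesColimitsOfShape P (coyoneda.obj (op A)))

/-- A locally κ-presentable category. -/
structure IsLocallyPresentable (κ : Cardinal.{v}) (K : Type u) [Category.{v} K] : Prop where
  regular : κ.IsRegular
  hasColimits : HasColimits K
  generators : ∃ (ι : Type v) (G : ι → K), (∀ i, IsCardinalPresentable κ (G i)) ∧
    ∀ X : K, ∃ (P : Type v) (_ : Preorder P) (F : P ⥤ K) (c : Cocone F) (_ : IsColimit c),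
      IsCardinalDirected P κ ∧ Nonempty (c.pt ≅ X) ∧ ∀ p : P, ∃ i, Nonempty (F.obj p ≅ G i)

/-- A locally presentable category. -/
def LocallyPresentable (K : Type u) [Category.{v} K] : Prop :=
  ∃ κ : Cardinal.{v}, IsLocallyPresentable κ K

/-- The smallest cellular class containing `X`. -/
def cellClosure (X : MorphismProperty K) : MorphismProperty K :=
  fun _ _ f => ∀ C : MorphismProperty K, IsCellular C → X ≤ C → C f

/-- `cof(X)`: retracts of transfinite composites of pushouts of `X`. -/
def cofClosure (X : MorphismProperty K) : MorphismProperty K :=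
  retracts (IsTransfiniteCompositionOf.{v} (Po X))

/-- The morphism property generated by a family of morphisms. -/
def ofFamily {ι : Type*} {a b : ι → K} (s : ∀ i, a i ⟶ b i) : MorphismProperty K :=
  fun _ _ f => ∃ i, Nonempty (Arrow.mk f ≅ Arrow.mk (s i))

/-- `C` is cofibrantly generated by a set of morphisms. -/
def IsCofibrantlyGenerated (C : MorphismProperty K) : Prop :=
  ∃ (ι : Type v) (a b : ι → K) (s : ∀ i, a i ⟶ b i),
    C = cofClosure (ofFamily s)

/-- A combinatorial structure on a locally presentable category. -/
structure IsCombinatorial (K : Type u) [Category.{v} K] (C : MorphismProperty K) : Prop where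
  locallyPresentable : LocallyPresentable K
  cellular : IsCellular C
  retractClosed : retracts C ≤ C
  cofibrantlyGenerated : IsCofibrantlyGenerated C

/-- `f` is a transfinite composite of length `< κ` of morphisms in `C`. -/
def IsBoundedTransfiniteCompositionOf (κ : Cardinal.{v}) (C : MorphismProperty K) :
    MorphismProperty K :=
  fun A B f =>
    ∃ (J : Type v) (_ : LinearOrder J) (_ : SuccOrder J) (_ : OrderBot J)
      (_ : WellFoundedLT J), Cardinal.mk J < κ ∧
      ∃ (F : J ⥤ K) (c : Cocone F) (_ : IsColimit c)
        (eA : A ≅ F.obj ⊥) (eB : c.pt ≅ B),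
        (∀ j : J, ¬IsMax j → C (F.map (homOfLE (Order.le_succ j)))) ∧
        (∀ j : J, Order.IsSuccLimit j → Nonempty (IsColimit (coconeLT F j))) ∧
        eA.hom ≫ c.ι.app ⊥ ≫ eB.hom = f

/-- The morphisms of `C` with κ-presentable domain and codomain. -/
def betweenPresentable (κ : Cardinal.{v}) (C : MorphismProperty K) : MorphismProperty K :=
  fun A B f => C f ∧ IsCardinalPresentable κ A ∧ IsCardinalPresentable κ B

/-- `Po_κ(X)`: pushouts of morphisms of `X` between κ-presentable objects. -/
def PoCard (κ : Cardinal.{v}) (X : MorphismProperty K) : MorphismProperty K :=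
  betweenPresentable κ (Po X)

/-- The category `psh(K²)`: objects are morphisms of `K`, morphisms are pushout squares. -/
structure PshArrow (K : Type u) [Category.{v} K] : Type max u v where
  arr : Arrow K

instance : Category.{v} (PshArrow K) where
  Hom g f := {φ : g.arr ⟶ f.arr // IsPushout g.arr.hom φ.left φ.right f.arr.hom}
  id g := ⟨𝟙 _, IsPushout.of_vert_isIso ⟨by simp⟩⟩
  comp φ ψ := ⟨φ.1 ≫ ψ.1, φ.2.paste_vert ψ.2⟩
  id_comp φ := Subtype.ext (Category.id_comp _)
  comp_id φ := Subtype.ext (Category.comp_id _)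
  assoc _ _ _ := Subtype.ext (Category.assoc _ _ _)

section PsPull

variable {K : Type u} {L : Type u'} {M : Type u''}
variable [Category.{v} K] [Category.{v} L] [Category.{v} M]

/-- The pseudopullback of `F : K ⥤ M` and `G : L ⥤ M`. -/
structure PsPull (F : K ⥤ M) (G : L ⥤ M) : Type max u u' v where
  k : K
  l : L
  t : F.obj k ≅ G.obj l

variable {F : K ⥤ M} {G : L ⥤ M}

/-- Morphisms in the pseudopullback. -/
@[ext]
structure PsHom (a b : PsPull F G) : Type v where
  hk : a.k ⟶ b.k
  hl : a.l ⟶ b.l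
  w : F.map hk ≫ b.t.hom = a.t.hom ≫ G.map hl

instance : Category.{v} (PsPull F G) where
  Hom := PsHom
  id a := ⟨𝟙 _, 𝟙 _, by simp⟩
  comp f g := ⟨f.hk ≫ g.hk, f.hl ≫ g.hl, by
    rw [F.map_comp, G.map_comp, Category.assoc, g.w, ← Category.assoc, f.w,
      Category.assoc]⟩

/-- The first projection of the pseudopullback. -/
def projK (F : K ⥤ M) (G : L ⥤ M) : PsPull F G ⥤ K where
  obj a := a.k
  map f := f.hk

/-- The second projection of the pseudopullback. -/
def projL (F : K ⥤ M) (G : L ⥤ M) : PsPull F G ⥤ L where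
  obj a := a.l
  map f := f.hl

/-- `Ps(C, D)`: morphisms of the pseudopullback whose projections lie in `C` and `D`. -/
def PsClass (C : MorphismProperty K) (D : MorphismProperty L) :
    MorphismProperty (PsPull F G) :=
  fun _ _ f => C f.hk ∧ D f.hl

end PsPull

open ZeroObject in
/-- The class of `S`-filtered objects: `X` such that `0 ⟶ X` is a transfinite composite
of monomorphisms with cokernels in `S`. -/
def filteredBy {K : Type u} [Category.{v} K] [Abelian K] (S : Set K) : Set K :=
  {X : K | IsTransfiniteCompositionOf.{v}
    (fun _ _ f => Mono f ∧ ∃ s ∈ S, Nonempty (cokernel f ≅ s))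
    (0 : (0 : K) ⟶ X)}

/-- A class of objects is deconstructible if it is the class of `S`-filtered objects
for some set `S`. -/
def Deconstructible {K : Type u} [Category.{v} K] [Abelian K] (C : Set K) : Prop :=
  ∃ (ι : Type v) (s : ι → K), C = filteredBy (Set.range s)

section Lattice

variable {L : Type*} [CompleteLattice L]

/-- Meets distribute over directed joins indexed by types in `Type v`. -/
def UpperContinuous (L : Type*) [CompleteLattice L] : Prop :=
  ∀ {ι : Type v} (f : ι → L) (a : L), Directed (· ≤ ·) f → a ⊓ ⨆ i, f i ≤ ⨆ i, a ⊓ f i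

/-- Every join of elements below `a` is a join of fewer than `κ` of them. -/
def IsSmallElement (κ : Cardinal.{v}) (a : L) : Prop :=
  ∀ (ι : Type v) (f : ι → L), (∀ i, f i ≤ a) →
    ∃ D : Set ι, Cardinal.mk D < κ ∧ ⨆ i, f i ≤ ⨆ i ∈ D, f i

/-- The join of the members of a family indexed by `I`. -/
def partialSup {J : Type v} (A : J → L) (I : Set J) : L := ⨆ j ∈ I, A j

lemma partialSup_mono {J : Type v} (A : J → L) {I I' : Set J} (h : I ⊆ I') :
    partialSup A I ≤ partialSup A I' :=
  biSup_mono h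

lemma le_partialSup {J : Type v} (A : J → L) {I : Set J} {j : J} (h : j ∈ I) :
    A j ≤ partialSup A I :=
  le_biSup A h

lemma partialSup_le {J : Type v} {A : J → L} {I : Set J} {a : L} (h : ∀ j ∈ I, A j ≤ a) :
    partialSup A I ≤ a :=
  iSup₂_le h

lemma iSup_eq_iSup_finset_partialSup {ι : Type v} (f : ι → L) :
    ⨆ i, f i = ⨆ s : Finset ι, partialSup f (s : Set ι) := by
  apply le_antisymm
  · exact iSup_le fun i => le_trans (le_partialSup f (by simp : i ∈ (({i} : Finset ι) : Set ι)))
      (le_iSup (fun s : Finset ι => partialSup f (s : Set ι)) {i})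
  · exact iSup_le fun s => partialSup_le fun j _ => le_iSup f j

lemma directed_finset_partialSup {ι : Type v} (f : ι → L) :
    Directed (· ≤ ·) fun s : Finset ι => partialSup f (s : Set ι) := by
  classical
  intro s t
  exact ⟨s ∪ t, partialSup_mono f (by simp), partialSup_mono f (by simp)⟩

lemma IsSmallElement.mono {κ : Cardinal.{v}} {a b : L} (hb : IsSmallElement κ b) (h : a ≤ b) :
    IsSmallElement κ a :=
  fun ι f hf => hb ι f fun i => (hf i).trans h

/-- An element is small if the elements below it are classified by fewer than `κ` values. -/
lemma isSmallElement_of_injOn {κ : Cardinal.{v}} {a : L} {Λ : Type v}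
    (hΛ : Cardinal.mk Λ < κ) (φ : L → Λ) (hφ : Set.InjOn φ (Set.Iic a)) :
    IsSmallElement κ a := by
  intro ι f hf
  classical
  let t : Set Λ := Set.range fun i => φ (f i)
  have ht (x : t) : ∃ i, φ (f i) = x := x.2
  choose g hg using ht
  refine ⟨Set.range g, (Cardinal.mk_range_le.trans (Cardinal.mk_set_le t)).trans_lt hΛ, ?_⟩
  refine iSup_le fun i => ?_
  have h1 : f (g ⟨φ (f i), i, rfl⟩) = f i := hφ (hf _) (hf _) (hg ⟨φ (f i), i, rfl⟩)
  rw [← h1]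
  exact le_biSup f (Set.mem_range_self _)

lemma mk_biUnion_finset_lt {κ : Cardinal.{v}} (hκ : κ.IsRegular) {ι : Type v}
    {D : Set (Finset ι)} (hD : Cardinal.mk D < κ) :
    Cardinal.mk (⋃ s ∈ D, (s : Set ι)) < κ := by
  rw [Cardinal.card_biUnion_lt_iff_forall_of_isRegular hκ hD]
  intro s _
  exact (Cardinal.lt_aleph0_of_finite _).trans_le hκ.aleph0_le

lemma IsSmallElement.exists_le_partialSup {κ : Cardinal.{v}} (hκ : κ.IsRegular)
    (hL : UpperContinuous.{v} L) {a : L} (ha : IsSmallElement κ a) {ι : Type v} (f : ι → L)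
    (h : a ≤ ⨆ i, f i) : ∃ D : Set ι, Cardinal.mk D < κ ∧ a ≤ partialSup f D := by
  obtain ⟨D, hD, hle⟩ := ha (Finset ι) (fun s => a ⊓ partialSup f (s : Set ι))
    fun _ => inf_le_left
  refine ⟨⋃ s ∈ D, (s : Set ι), mk_biUnion_finset_lt hκ hD, ?_⟩
  have h1 : a ≤ ⨆ s : Finset ι, a ⊓ partialSup f (s : Set ι) := by
    refine le_trans (le_inf le_rfl ?_) (hL _ a (directed_finset_partialSup f))
    rwa [← iSup_eq_iSup_finset_partialSup]
  refine h1.trans (hle.trans (iSup₂_le fun s hs => inf_le_right.trans ?_))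
  exact partialSup_mono f (Set.subset_biUnion_of_mem (u := fun s : Finset ι => (s : Set ι)) hs)

lemma IsSmallElement.sup [IsModularLattice L] {κ : Cardinal.{v}} (hκ : κ.IsRegular)
    (hL : UpperContinuous.{v} L) {a b : L} (ha : IsSmallElement κ a) (hb : IsSmallElement κ b) :
    IsSmallElement κ (a ⊔ b) := by
  intro ι f hf
  set m := ⨆ i, f i with hm
  have hmab : m ≤ a ⊔ b := iSup_le hf
  obtain ⟨D₁, hD₁, h₁⟩ := (ha.mono (inf_le_right : m ⊓ a ≤ a)).exists_le_partialSup hκ hL f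
    inf_le_left
  obtain ⟨D', hD', h'⟩ := hb (Finset ι) (fun s => b ⊓ (a ⊔ partialSup f (s : Set ι)))
    fun _ => inf_le_left
  set D₂ := ⋃ s ∈ D', (s : Set ι)
  have h₂ : b ⊓ (a ⊔ m) ≤ a ⊔ partialSup f D₂ := by
    have hdir : Directed (· ≤ ·) fun s : Finset ι => a ⊔ partialSup f (s : Set ι) :=
      (directed_finset_partialSup f).mono_comp _ (g := fun x => a ⊔ x)
        fun x y h => sup_le_sup_left h a
    have h3 := hL _ b hdir
    rw [← sup_iSup, ← iSup_eq_iSup_finset_partialSup] at h3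
    refine h3.trans (h'.trans (iSup₂_le fun s hs => inf_le_right.trans ?_))
    exact sup_le_sup_left (partialSup_mono f
      (Set.subset_biUnion_of_mem (u := fun s : Finset ι => (s : Set ι)) hs)) a
  refine ⟨D₁ ∪ D₂, (Cardinal.mk_union_le _ _).trans_lt
    (Cardinal.add_lt_of_lt hκ.aleph0_le hD₁ (mk_biUnion_finset_lt hκ hD')), ?_⟩
  change m ≤ partialSup f (D₁ ∪ D₂)
  set p := partialSup f (D₁ ∪ D₂)
  have hpm : p ≤ m := partialSup_le fun j _ => le_iSup f j
  have h4 : m ≤ a ⊔ p := by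
    have : (a ⊔ b) ⊓ (a ⊔ m) = a ⊔ b ⊓ (a ⊔ m) := sup_inf_assoc_of_le b le_sup_left
    calc m ≤ (a ⊔ b) ⊓ (a ⊔ m) := le_inf hmab le_sup_right
      _ = a ⊔ b ⊓ (a ⊔ m) := this
      _ ≤ a ⊔ p := sup_le le_sup_left
        (h₂.trans (sup_le_sup_left (partialSup_mono f Set.subset_union_right) a))
  have h5 : (p ⊔ a) ⊓ m = p ⊔ a ⊓ m := sup_inf_assoc_of_le a hpm
  calc m ≤ (p ⊔ a) ⊓ m := le_inf (by rwa [sup_comm]) le_rfl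
    _ = p ⊔ a ⊓ m := h5
    _ ≤ p := sup_le le_rfl (by
      rw [inf_comm]; exact h₁.trans (partialSup_mono f Set.subset_union_left))

lemma isSmallElement_bot {κ : Cardinal.{v}} (hκ : κ.IsRegular) :
    IsSmallElement κ (⊥ : L) := by
  intro ι f hf
  refine ⟨∅, ?_, iSup_le fun i => (hf i).trans bot_le⟩
  simpa using hκ.pos

lemma IsSmallElement.iSup [IsModularLattice L] {κ : Cardinal.{v}} (hκ : κ.IsRegular)
    (hκ' : Cardinal.aleph0 < κ) (hL : UpperContinuous.{v} L) {σ : Type v}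
    (hσ : Cardinal.mk σ < κ) {a : σ → L} (ha : ∀ i, IsSmallElement κ (a i)) :
    IsSmallElement κ (⨆ i, a i) := by
  classical
  have hfin (s : Finset σ) : IsSmallElement κ (partialSup a (s : Set σ)) := by
    induction s using Finset.induction_on with
    | empty =>
      have : partialSup a ((∅ : Finset σ) : Set σ) = ⊥ := by simp [partialSup]
      rw [this]
      exact isSmallElement_bot hκ
    | insert i s _ ih =>
      have : partialSup a ((insert i s : Finset σ) : Set σ) = a i ⊔ partialSup a (s : Set σ) := by
        rw [Finset.coe_insert]
        exact iSup_insert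
      rw [this]
      exact (ha i).sup hκ hL ih
  intro ι f hf
  set m := ⨆ i, f i
  have hm : m ≤ ⨆ i, a i := iSup_le hf
  have hm' : m ≤ ⨆ s : Finset σ, m ⊓ partialSup a (s : Set σ) := by
    refine le_trans (le_inf le_rfl ?_) (hL _ m (directed_finset_partialSup a))
    rwa [← iSup_eq_iSup_finset_partialSup]
  have h (s : Finset σ) := ((hfin s).mono
    (inf_le_right : m ⊓ _ ≤ _)).exists_le_partialSup hκ hL f inf_le_left
  choose D hD hDle using h
  have hcard : Cardinal.mk (Finset σ) < κ := by
    cases finite_or_infinite σ with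
    | inl _ => exact (Cardinal.lt_aleph0_of_finite _).trans hκ'
    | inr _ => rwa [Cardinal.mk_finset_of_infinite]
  refine ⟨⋃ s, D s, (Cardinal.card_iUnion_lt_iff_forall_of_isRegular hκ hcard).2 hD, ?_⟩
  refine hm'.trans (iSup_le fun s => (hDle s).trans ?_)
  exact partialSup_mono f (Set.subset_iUnion D s)

section Family

variable {J : Type v} [LinearOrder J]

/-- The closure condition on index sets of the Hill lemma. -/
def HillClosed (A : J → L) (I : Set J) : Prop :=
  ∀ j ∈ I, A j ⊓ partialSup A (Set.Iio j) ≤ partialSup A (I ∩ Set.Iio j)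

lemma HillClosed.union_inter_of_subset {A : J → L} {I I' D : Set J} (hI : HillClosed A I)
    (hI' : HillClosed A I') (hD : IsLowerSet D) : HillClosed A (I ∪ I' ∩ D) := by
  intro j hj
  obtain hj | ⟨hj, hjD⟩ := hj
  · exact (hI j hj).trans (partialSup_mono A (Set.inter_subset_inter_left _
      Set.subset_union_left))
  · refine (hI' j hj).trans (partialSup_mono A ?_)
    rintro i ⟨hi, hij⟩
    exact ⟨Or.inr ⟨hi, hD (le_of_lt hij) hjD⟩, hij⟩

lemma partialSup_Iio_le_iSup (A : J → L) (I : Set J) (e : J) :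
    partialSup A (I ∩ Set.Iio e) ≤ ⨆ d : Set.Iio e, partialSup A (I ∩ Set.Iic (d : J)) :=
  partialSup_le fun j hj => (le_partialSup A (⟨hj.1, le_refl j⟩ : j ∈ I ∩ Set.Iic j)).trans
    (le_iSup (fun d : Set.Iio e => partialSup A (I ∩ Set.Iic (d : J))) ⟨j, hj.2⟩)

lemma directed_partialSup_Iic (A : J → L) (I : Set J) :
    Monotone fun d : J => partialSup A (I ∩ Set.Iic d) :=
  fun _ _ h => partialSup_mono A (Set.inter_subset_inter_right _ (Set.Iic_subset_Iic.2 h))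

lemma HillClosed.partialSup_inf_le [WellFoundedLT J] [IsModularLattice L]
    (hL : UpperContinuous.{v} L) {A : J → L} {I D : Set J} (hI : HillClosed A I)
    (hD : IsLowerSet D) : partialSup A I ⊓ partialSup A D ≤ partialSup A (I ∩ D) := by
  have key (e : J) : partialSup A D ⊓ partialSup A (I ∩ Set.Iic e) ≤ partialSup A (I ∩ D) := by
    induction e using WellFoundedLT.induction with
    | ind e ih =>
      by_cases heD : e ∈ D
      · refine inf_le_right.trans (partialSup_mono A (Set.inter_subset_inter_right _ ?_))
        exact fun i hi => hD hi heD
      · have hDe : D ⊆ Set.Iio e := fun i hi => by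
          by_contra h
          exact heD (hD (not_lt.1 h) hi)
        have h1 : partialSup A (Set.Iio e) ⊓ partialSup A (I ∩ Set.Iic e) ≤
            partialSup A (I ∩ Set.Iio e) := by
          by_cases heI : e ∈ I
          · have h2 : partialSup A (I ∩ Set.Iic e) ≤ partialSup A (I ∩ Set.Iio e) ⊔ A e := by
              refine partialSup_le fun i hi => ?_
              obtain h | h := (hi.2 : i ≤ e).eq_or_lt
              · rw [h]; exact le_sup_right
              · exact le_sup_of_le_left (le_partialSup A ⟨hi.1, h⟩)
            have h3 : (partialSup A (I ∩ Set.Iio e) ⊔ A e) ⊓ partialSup A (Set.Iio e) =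
                partialSup A (I ∩ Set.Iio e) ⊔ A e ⊓ partialSup A (Set.Iio e) :=
              sup_inf_assoc_of_le _ (partialSup_mono A Set.inter_subset_right)
            rw [inf_comm]
            exact (inf_le_inf_right _ h2).trans (h3.le.trans (sup_le le_rfl (hI e heI)))
          · refine inf_le_right.trans (partialSup_mono A fun i hi => ⟨hi.1, ?_⟩)
            exact lt_of_le_of_ne hi.2 fun h => heI (h ▸ hi.1)
        have h4 : partialSup A D ⊓ partialSup A (I ∩ Set.Iic e) ≤
            partialSup A D ⊓ ⨆ d : Set.Iio e, partialSup A (I ∩ Set.Iic (d : J)) :=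
          le_inf inf_le_left ((inf_le_inf_right _ (partialSup_mono A hDe)).trans
            (h1.trans (partialSup_Iio_le_iSup A I e)))
        refine h4.trans ((hL _ _ ?_).trans (iSup_le fun d => ih d d.2))
        exact ((directed_partialSup_Iic A I).comp (Subtype.mono_coe _)).directed_le
  have h5 : partialSup A I ≤ ⨆ e, partialSup A (I ∩ Set.Iic e) :=
    partialSup_le fun j hj => (le_partialSup A (⟨hj, le_refl j⟩ : j ∈ I ∩ Set.Iic j)).trans
      (le_iSup (fun d : J => partialSup A (I ∩ Set.Iic d)) j)
  rw [inf_comm]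
  exact (inf_le_inf_left _ h5).trans ((hL _ _ (directed_partialSup_Iic A I).directed_le).trans
    (iSup_le key))

lemma partialSup_eq_of_sup_eq [WellFoundedLT J] {A A' : J → L} (hle : ∀ j, A' j ≤ A j)
    (h : ∀ j, A j ≤ partialSup A (Set.Iio j) ⊔ A' j) {D : Set J} (hD : IsLowerSet D) :
    partialSup A' D = partialSup A D := by
  have key (j : J) : A j ≤ partialSup A' (Set.Iic j) := by
    induction j using WellFoundedLT.induction with
    | ind j ih =>
      refine (h j).trans (sup_le (partialSup_le fun i hi => (ih i hi).trans
        (partialSup_mono A' (Set.Iic_subset_Iic.2 (le_of_lt hi))))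
        (le_partialSup A' (le_refl j)))
  apply le_antisymm
  · exact partialSup_le fun j hj => (hle j).trans (le_partialSup A hj)
  · exact partialSup_le fun j hj => (key j).trans (partialSup_mono A' fun i hi => hD hi hj)

end Family

/-- A relation with fewer than `κ` successors at each point has closures of size less than `κ`. -/
lemma exists_small_closure {κ : Cardinal.{v}} (hκ : κ.IsRegular) (hκ' : Cardinal.aleph0 < κ)
    {J : Type v} (E : J → Set J) (hE : ∀ j, Cardinal.mk (E j) < κ) (j : J) :
    ∃ I : Set J, j ∈ I ∧ Cardinal.mk I < κ ∧ ∀ i ∈ I, E i ⊆ I := by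
  let S : ℕ → Set J := fun n => Nat.rec ({j} : Set J) (fun _ s => ⋃ i ∈ s, E i) n
  have hS (n : ℕ) : Cardinal.mk ↥(S n) < κ := by
    induction n with
    | zero => simpa [S] using Cardinal.one_lt_aleph0.trans hκ'
    | succ n ih =>
      change Cardinal.mk (⋃ i ∈ S n, E i) < κ
      exact (Cardinal.card_biUnion_lt_iff_forall_of_isRegular hκ ih).2 fun i _ => hE i
  refine ⟨⋃ n : ULift.{v} ℕ, S n.down, Set.mem_iUnion.2 ⟨⟨0⟩, rfl⟩, ?_, ?_⟩
  · exact (Cardinal.card_iUnion_lt_iff_forall_of_isRegular hκ (by simpa using hκ')).2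
      fun n => hS n.down
  · intro i hi
    obtain ⟨n, hn⟩ := Set.mem_iUnion.1 hi
    intro k hk
    exact Set.mem_iUnion.2 ⟨⟨n.down + 1⟩, Set.mem_biUnion hn hk⟩

end Lattice

section Subobjects

variable {K : Type u} [Category.{v} K]

lemma factors_comp_arrow {X W : K} {x : Subobject X} (g : W ⟶ (x : K)) :
    x.Factors (g ≫ x.arrow) :=
  Subobject.factors_comp_arrow g

lemma le_of_forall_factors {X : K} {x y : Subobject X}
    (h : ∀ ⦃W : K⦄ (g : W ⟶ X), x.Factors g → y.Factors g) : x ≤ y :=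
  Subobject.le_of_comm (y.factorThru _ (h x.arrow (by simpa using factors_comp_arrow (𝟙 (x : K)))))
    (Subobject.factorThru_arrow _ _ _)

variable [Abelian K]

lemma factors_iff_comp_cokernel_eq_zero {X W : K} (N : Subobject X) (g : W ⟶ X) :
    N.Factors g ↔ g ≫ cokernel.π N.arrow = 0 := by
  constructor
  · intro h
    rw [← N.factorThru_arrow g h, assoc, cokernel.condition, comp_zero]
  · intro h
    refine (Subobject.factors_iff _ _).2 ⟨Abelian.monoLift N.arrow g h, ?_⟩
    exact Abelian.monoLift_comp N.arrow g h

lemma factors_of_epi_comp {X W W' : K} (N : Subobject X) (π : W' ⟶ W) [Epi π] (g : W ⟶ X)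
    (h : N.Factors (π ≫ g)) : N.Factors g := by
  rw [factors_iff_comp_cokernel_eq_zero, assoc] at h
  rw [factors_iff_comp_cokernel_eq_zero, ← cancel_epi π, h, comp_zero]

lemma imageSubobject_factors_iff {X Y W : K} (f : X ⟶ Y) (g : W ⟶ Y) :
    (imageSubobject f).Factors g ↔
      ∃ (W' : K) (π : W' ⟶ W) (_ : Epi π) (h : W' ⟶ X), π ≫ g = h ≫ f := by
  constructor
  · intro hg
    obtain ⟨W', π, hπ, h, e⟩ := surjective_up_to_refinements_of_epi
      (factorThruImageSubobject f) ((imageSubobject f).factorThru g hg)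
    refine ⟨W', π, hπ, h, ?_⟩
    have := e =≫ (imageSubobject f).arrow
    simpa using this
  · rintro ⟨W', π, hπ, h, e⟩
    apply factors_of_epi_comp _ π
    rw [e]
    exact imageSubobject_factors_comp_self (f := f) h

lemma imageSubobject_le_iff_factors {X Y : K} (f : X ⟶ Y) (N : Subobject Y) :
    imageSubobject f ≤ N ↔ N.Factors f := by
  constructor
  · intro h
    have := imageSubobject_factors_comp_self (f := f) (𝟙 X)
    rw [id_comp] at this
    exact Subobject.factors_of_le f h this
  · exact fun h => imageSubobject_le f (N.factorThru f h) (by simp)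

/-- The image of a subobject under a morphism. -/
noncomputable def imageOf {X Y : K} (f : X ⟶ Y) (x : Subobject X) : Subobject Y :=
  imageSubobject (x.arrow ≫ f)

lemma factors_arrow_comp_iff {X Y : K} (f : X ⟶ Y) (x : Subobject X) (N : Subobject Y) :
    N.Factors (x.arrow ≫ f) ↔ x ≤ (Subobject.pullback f).obj N := by
  rw [← Limits.pullback_factors_iff]
  constructor
  · exact fun h => Subobject.le_of_comm (Subobject.factorThru _ _ h) (by simp)
  · exact fun h => (Subobject.factors_iff _ _).2 ⟨Subobject.ofLE _ _ h, Subobject.ofLE_arrow _⟩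

lemma gc_imageOf_pullback {X Y : K} (f : X ⟶ Y) :
    GaloisConnection (imageOf f) (Subobject.pullback f).obj := by
  intro x N
  rw [imageOf, imageSubobject_le_iff_factors, factors_arrow_comp_iff]

lemma imageOf_factors_iff {X Y W : K} (f : X ⟶ Y) (x : Subobject X) (g : W ⟶ Y) :
    (imageOf f x).Factors g ↔
      ∃ (W' : K) (π : W' ⟶ W) (_ : Epi π) (h : W' ⟶ X), x.Factors h ∧ π ≫ g = h ≫ f := by
  rw [imageOf, imageSubobject_factors_iff]
  constructor
  · rintro ⟨W', π, hπ, h, e⟩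
    exact ⟨W', π, hπ, h ≫ x.arrow, factors_comp_arrow h, by simpa using e⟩
  · rintro ⟨W', π, hπ, h, hx, e⟩
    exact ⟨W', π, hπ, x.factorThru h hx, by simpa using e⟩

lemma sup_factors_iff {X W : K} (x y : Subobject X) (g : W ⟶ X) :
    (x ⊔ y).Factors g ↔ ∃ (W' : K) (π : W' ⟶ W) (_ : Epi π) (a b : W' ⟶ X),
      x.Factors a ∧ y.Factors b ∧ π ≫ g = a + b := by
  constructor
  · intro hg
    have hle : x ⊔ y ≤ imageSubobject (biprod.desc x.arrow y.arrow) := by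
      refine sup_le ?_ ?_
      · apply Subobject.le_of_comm (biprod.inl ≫ factorThruImageSubobject _)
        simp
      · apply Subobject.le_of_comm (biprod.inr ≫ factorThruImageSubobject _)
        simp
    obtain ⟨W', π, hπ, h, e⟩ := (imageSubobject_factors_iff _ _).1
      (Subobject.factors_of_le g hle hg)
    refine ⟨W', π, hπ, h ≫ biprod.fst ≫ x.arrow, h ≫ biprod.snd ≫ y.arrow, ?_, ?_, ?_⟩
    · rw [← assoc]; exact factors_comp_arrow _
    · rw [← assoc]; exact factors_comp_arrow _
    · rw [e, ← Preadditive.comp_add]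
      congr 1
      ext <;> simp
  · rintro ⟨W', π, hπ, a, b, ha, hb, e⟩
    apply factors_of_epi_comp _ π
    rw [e]
    exact Subobject.factors_add a b (Subobject.factors_of_le a le_sup_left ha)
      (Subobject.factors_of_le b le_sup_right hb)

lemma factors_sub {X W : K} {x : Subobject X} {a b : W ⟶ X} (ha : x.Factors a)
    (hb : x.Factors b) : x.Factors (a - b) := by
  rw [factors_iff_comp_cokernel_eq_zero] at *
  rw [Preadditive.sub_comp, ha, hb, sub_zero]

instance isModularLattice_subobject [LocallySmall.{w} K] [WellPowered.{w} K] (X : K) :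
    IsModularLattice (Subobject X) where
  sup_inf_le_assoc_of_le {x} y z hxz := by
    apply le_of_forall_factors
    intro W g hg
    obtain ⟨hg1, hg2⟩ := (Subobject.inf_factors g).1 hg
    obtain ⟨W', π, hπ, a, b, ha, hb, e⟩ := (sup_factors_iff _ _ _).1 hg1
    refine (sup_factors_iff _ _ _).2 ⟨W', π, hπ, a, b, ha, ?_, e⟩
    refine (Subobject.inf_factors b).2 ⟨hb, ?_⟩
    have hb' : b = π ≫ g - a := by rw [e]; abel
    rw [hb']
    exact factors_sub (Subobject.factors_of_factors_right π hg2) (Subobject.factors_of_le a hxz ha)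

end Subobjects

section Quotients

variable {K : Type u} [Category.{v} K] [Abelian K]

/-- `s` is a quotient of the subobject `y` by the subobject `x ≤ y`. -/
def IsQuotient {X : K} (x y : Subobject X) (s : K) : Prop :=
  x ≤ y ∧ ∃ p : (y : K) ⟶ s, Epi p ∧
    ∀ ⦃W : K⦄ (g : W ⟶ (y : K)), g ≫ p = 0 ↔ x.Factors (g ≫ y.arrow)

lemma isQuotient_mk_iff {A B X : K} (i : A ⟶ X) [Mono i] (i' : B ⟶ X) [Mono i'] (f : A ⟶ B)
    (hf : f ≫ i' = i) (s : K) :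
    IsQuotient (Subobject.mk i) (Subobject.mk i') s ↔ Nonempty (cokernel f ≅ s) := by
  have hmono : Mono f := by
    have : Mono (f ≫ i') := by rw [hf]; infer_instance
    exact mono_of_mono f i'
  let e := Subobject.underlyingIso i'
  have he : e.inv ≫ (Subobject.mk i').arrow = i' := Subobject.underlyingIso_arrow i'
  have he' : e.hom ≫ i' = (Subobject.mk i').arrow := Subobject.underlyingIso_hom_comp_eq_mk i'
  have hfac {W : K} (g : W ⟶ B) : (Subobject.mk i).Factors (g ≫ i') ↔
      g ≫ cokernel.π f = 0 := by
    rw [Subobject.mk_factors_iff]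
    constructor
    · rintro ⟨(h : W ⟶ A), (hh : h ≫ i = g ≫ i')⟩
      have : g = h ≫ f := by rw [← cancel_mono i', assoc, hf, hh]
      rw [this, assoc, cokernel.condition, comp_zero]
    · intro h
      refine ⟨Abelian.monoLift f g h, ?_⟩
      change Abelian.monoLift f g h ≫ i = _
      rw [← hf, Abelian.monoLift_comp_assoc]
  constructor
  · rintro ⟨hle, p, hp, h⟩
    have h0 : f ≫ e.inv ≫ p = 0 := by
      rw [← assoc, h, assoc, he, hfac, cokernel.condition]
    have hepi : Epi (cokernel.desc f (e.inv ≫ p) h0) := by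
      have : Epi (cokernel.π f ≫ cokernel.desc f (e.inv ≫ p) h0) := by
        rw [cokernel.π_desc]; infer_instance
      exact epi_of_epi (cokernel.π f) _
    have hmono : Mono (cokernel.desc f (e.inv ≫ p) h0) := by
      refine Preadditive.mono_of_cancel_zero _ fun {W} g hg => ?_
      obtain ⟨W', π, hπ, k, hk⟩ := surjective_up_to_refinements_of_epi (cokernel.π f) g
      rw [← cancel_epi π, hk, comp_zero, ← hfac]
      have := π ≫= hg
      rw [reassoc_of% hk, cokernel.π_desc, comp_zero, ← assoc, h, assoc, he] at this
      exact this
    have := isIso_of_mono_of_epi (cokernel.desc f (e.inv ≫ p) h0)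
    exact ⟨asIso (cokernel.desc f (e.inv ≫ p) h0)⟩
  · rintro ⟨t⟩
    refine ⟨Subobject.mk_le_mk_of_comm f hf, e.hom ≫ cokernel.π f ≫ t.hom, inferInstance, ?_⟩
    intro W g
    rw [← he', ← assoc g, ← assoc g, hfac]
    constructor
    · intro h0
      rw [← cancel_mono t.hom]
      simpa using h0
    · intro h0
      rw [← assoc, h0, zero_comp]

lemma IsQuotient.of_iso {X : K} {x y : Subobject X} {s s' : K} (h : IsQuotient x y s)
    (e : s ≅ s') : IsQuotient x y s' := by
  obtain ⟨hle, p, hp, h⟩ := h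
  refine ⟨hle, p ≫ e.hom, inferInstance, fun W g => ?_⟩
  rw [← h g, ← assoc]
  constructor
  · intro h0
    rw [← cancel_mono e.hom, h0, zero_comp]
  · intro h0
    rw [h0, zero_comp]

lemma isQuotient_iff {X : K} {x y : Subobject X} (hxy : x ≤ y) (s : K) :
    IsQuotient x y s ↔ Nonempty (cokernel (Subobject.ofLE x y hxy) ≅ s) := by
  have := isQuotient_mk_iff x.arrow y.arrow (Subobject.ofLE x y hxy) (Subobject.ofLE_arrow _) s
  rwa [Subobject.mk_arrow, Subobject.mk_arrow] at this

lemma exists_isQuotient {X : K} {x y : Subobject X} (hxy : x ≤ y) : ∃ s, IsQuotient x y s :=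
  ⟨_, (isQuotient_iff hxy _).2 ⟨Iso.refl _⟩⟩

lemma IsQuotient.nonempty_iso {X : K} {x y : Subobject X} {s s' : K} (h : IsQuotient x y s)
    (h' : IsQuotient x y s') : Nonempty (s ≅ s') := by
  obtain ⟨e⟩ := (isQuotient_iff h.1 _).1 h
  obtain ⟨e'⟩ := (isQuotient_iff h.1 _).1 h'
  exact ⟨e.symm ≪≫ e'⟩

lemma IsQuotient.inf_of_sup {X : K} {x a : Subobject X} {s : K} (h : IsQuotient x (x ⊔ a) s) :
    IsQuotient (x ⊓ a) a s := by
  obtain ⟨hle, p, hp, h⟩ := h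
  refine ⟨inf_le_right, Subobject.ofLE a (x ⊔ a) le_sup_right ≫ p, ?_, fun W g => ?_⟩
  · rw [epi_iff_surjective_up_to_refinements]
    intro W g
    obtain ⟨W₁, π₁, hπ₁, g₁, e₁⟩ := surjective_up_to_refinements_of_epi p g
    obtain ⟨W₂, π₂, hπ₂, c, d, hc, hd, e₂⟩ := (sup_factors_iff _ _ _).1
      (factors_comp_arrow g₁)
    refine ⟨W₂, π₂ ≫ π₁, epi_comp _ _, a.factorThru d hd, ?_⟩
    rw [assoc, e₁, ← assoc, ← assoc, ← sub_eq_zero, ← Preadditive.sub_comp, h]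
    have : (π₂ ≫ g₁ - a.factorThru d hd ≫ Subobject.ofLE a (x ⊔ a) le_sup_right) ≫
        (x ⊔ a).arrow = c := by
      simp [Preadditive.sub_comp, e₂]
    rwa [this]
  · rw [← assoc, h, Subobject.inf_factors]
    simp [factors_comp_arrow]

lemma isQuotient_sup_iff {X : K} {x a : Subobject X} {s : K} :
    IsQuotient x (x ⊔ a) s ↔ IsQuotient (x ⊓ a) a s := by
  refine ⟨IsQuotient.inf_of_sup, fun h => ?_⟩
  obtain ⟨s', h'⟩ := exists_isQuotient (le_sup_left : x ≤ x ⊔ a)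
  obtain ⟨e⟩ := h'.inf_of_sup.nonempty_iso h
  exact h'.of_iso e

/-- The preimage in `X` of a subobject of a quotient of `y ≤ X`. -/
noncomputable def liftSub {X Q : K} {y : Subobject X} (p : (y : K) ⟶ Q) (Z : Subobject Q) :
    Subobject X :=
  Subobject.mk (((Subobject.pullback p).obj Z).arrow ≫ y.arrow)

/-- The subobject of a quotient of `y ≤ X` induced by a subobject of `X`. -/
noncomputable def descSub {X Q : K} {y : Subobject X} (p : (y : K) ⟶ Q) (w : Subobject X) :
    Subobject Q :=
  imageOf p ((Subobject.pullback y.arrow).obj w)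

lemma liftSub_factors_iff {X Q W : K} {y : Subobject X} (p : (y : K) ⟶ Q) (Z : Subobject Q)
    (g : W ⟶ X) : (liftSub p Z).Factors g ↔ ∃ h : W ⟶ (y : K), h ≫ y.arrow = g ∧
      Z.Factors (h ≫ p) := by
  rw [liftSub, Subobject.mk_factors_iff]
  constructor
  · rintro ⟨h, rfl⟩
    refine ⟨h ≫ ((Subobject.pullback p).obj Z).arrow, assoc _ _ _, ?_⟩
    exact (Limits.pullback_factors_iff _ _ _).1 (factors_comp_arrow h)
  · rintro ⟨h, rfl, hZ⟩
    refine ⟨((Subobject.pullback p).obj Z).factorThru h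
      ((Limits.pullback_factors_iff _ _ _).2 hZ), ?_⟩
    exact Subobject.factorThru_arrow_assoc _ _ _ y.arrow

lemma liftSub_comp_factors_iff {X Q W : K} {y : Subobject X} (p : (y : K) ⟶ Q) (Z : Subobject Q)
    (h : W ⟶ (y : K)) : (liftSub p Z).Factors (h ≫ y.arrow) ↔ Z.Factors (h ≫ p) := by
  rw [liftSub_factors_iff]
  refine ⟨?_, fun hZ => ⟨h, rfl, hZ⟩⟩
  rintro ⟨h', e, hZ⟩
  rwa [(cancel_mono y.arrow).1 e] at hZ

lemma liftSub_le {X Q : K} {y : Subobject X} (p : (y : K) ⟶ Q) (Z : Subobject Q) :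
    liftSub p Z ≤ y :=
  le_of_forall_factors fun W g hg => by
    obtain ⟨h, rfl, -⟩ := (liftSub_factors_iff p Z g).1 hg
    exact factors_comp_arrow h

lemma liftSub_mono {X Q : K} {y : Subobject X} (p : (y : K) ⟶ Q) : Monotone (liftSub p) :=
  fun _ _ hZ => le_of_forall_factors fun W g hg => by
    obtain ⟨h, rfl, h'⟩ := (liftSub_factors_iff p _ g).1 hg
    exact (liftSub_comp_factors_iff p _ h).2 (Subobject.factors_of_le _ hZ h')

lemma descSub_mono {X Q : K} {y : Subobject X} (p : (y : K) ⟶ Q) : Monotone (descSub p) :=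
  fun _ _ hw => (gc_imageOf_pullback p).monotone_l (Functor.monotone _ hw)

lemma descSub_factors_iff {X Q W : K} {y : Subobject X} (p : (y : K) ⟶ Q) (w : Subobject X)
    (g : W ⟶ Q) : (descSub p w).Factors g ↔ ∃ (W' : K) (π : W' ⟶ W) (_ : Epi π)
      (h : W' ⟶ (y : K)), w.Factors (h ≫ y.arrow) ∧ π ≫ g = h ≫ p := by
  simp only [descSub, imageOf_factors_iff, Limits.pullback_factors_iff]

lemma descSub_liftSub {X Q : K} {y : Subobject X} (p : (y : K) ⟶ Q) [Epi p] (Z : Subobject Q) :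
    descSub p (liftSub p Z) = Z := by
  apply le_antisymm
  · refine le_of_forall_factors fun W g hg => ?_
    obtain ⟨W', π, hπ, h, hw, e⟩ := (descSub_factors_iff _ _ _).1 hg
    apply factors_of_epi_comp _ π
    rwa [e, ← liftSub_comp_factors_iff]
  · refine le_of_forall_factors fun W g hg => ?_
    obtain ⟨W', π, hπ, h, e⟩ := surjective_up_to_refinements_of_epi p g
    refine (descSub_factors_iff _ _ _).2 ⟨W', π, hπ, h, ?_, e⟩
    rw [liftSub_comp_factors_iff, ← e]
    exact Subobject.factors_of_factors_right π hg

lemma liftSub_descSub {X Q : K} {x y : Subobject X} (p : (y : K) ⟶ Q)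
    (hp : ∀ ⦃W : K⦄ (g : W ⟶ (y : K)), g ≫ p = 0 ↔ x.Factors (g ≫ y.arrow))
    {w : Subobject X} (hxw : x ≤ w) (hwy : w ≤ y) : liftSub p (descSub p w) = w := by
  apply le_antisymm
  · refine le_of_forall_factors fun W g hg => ?_
    obtain ⟨h, rfl, hg'⟩ := (liftSub_factors_iff _ _ _).1 hg
    obtain ⟨W', π, hπ, h', hw, e⟩ := (descSub_factors_iff _ _ _).1 hg'
    apply factors_of_epi_comp _ π
    have : (π ≫ h - h') ≫ p = 0 := by
      rw [Preadditive.sub_comp, assoc, e, sub_self]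
    have h2 := Subobject.factors_add _ _ (Subobject.factors_of_le _ hxw ((hp _).1 this)) hw
    simpa [Preadditive.sub_comp] using h2
  · refine le_of_forall_factors fun W g hg => ?_
    refine (liftSub_factors_iff _ _ _).2 ⟨y.factorThru g (Subobject.factors_of_le _ hwy hg),
      by simp, ?_⟩
    refine (descSub_factors_iff _ _ _).2 ⟨W, 𝟙 W, inferInstance, y.factorThru g
      (Subobject.factors_of_le _ hwy hg), by simpa using hg, by simp⟩

lemma IsQuotient.liftSub {X Q : K} {y : Subobject X} (p : (y : K) ⟶ Q) [Epi p]
    {Z Z' : Subobject Q} {s : K} (h : IsQuotient Z Z' s) :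
    IsQuotient (liftSub p Z) (liftSub p Z') s := by
  obtain ⟨hle, q, hq, h⟩ := h
  let t : ((CellularPaper.liftSub p Z' : Subobject X) : K) ⟶ (y : K) :=
    Subobject.ofLE _ _ (liftSub_le p Z')
  have ht : t ≫ y.arrow = (CellularPaper.liftSub p Z').arrow := Subobject.ofLE_arrow _
  have hfac : Z'.Factors (t ≫ p) := by
    rw [← liftSub_comp_factors_iff, ht]
    simpa using factors_comp_arrow (𝟙 ((CellularPaper.liftSub p Z' : Subobject X) : K))
  refine ⟨liftSub_mono p hle, Z'.factorThru _ hfac ≫ q, ?_, fun W g => ?_⟩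
  · refine @epi_comp _ _ _ _ _ _ ?_ _ _
    rw [epi_iff_surjective_up_to_refinements]
    intro W g
    obtain ⟨W', π, hπ, k, e⟩ := surjective_up_to_refinements_of_epi p (g ≫ Z'.arrow)
    have hk : (CellularPaper.liftSub p Z').Factors (k ≫ y.arrow) := by
      rw [liftSub_comp_factors_iff, ← e, ← assoc]
      exact factors_comp_arrow _
    refine ⟨W', π, hπ, (CellularPaper.liftSub p Z').factorThru _ hk, ?_⟩
    have h1 : (CellularPaper.liftSub p Z').factorThru _ hk ≫ t = k := by
      rw [← cancel_mono y.arrow, assoc, ht, Subobject.factorThru_arrow]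
    rw [← cancel_mono Z'.arrow, assoc, e, assoc, Subobject.factorThru_arrow, ← assoc, h1]
  · rw [← assoc, h, assoc, Subobject.factorThru_arrow, ← assoc, ← liftSub_comp_factors_iff,
      assoc, ht]

lemma IsQuotient.of_liftSub {X Q : K} {y : Subobject X} (p : (y : K) ⟶ Q) [Epi p]
    {Z Z' : Subobject Q} {s : K} (h : IsQuotient (CellularPaper.liftSub p Z)
      (CellularPaper.liftSub p Z') s) :
    IsQuotient Z Z' s := by
  have hle : Z ≤ Z' := by
    have := descSub_mono p h.1
    rwa [descSub_liftSub, descSub_liftSub] at this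
  obtain ⟨s', h'⟩ := exists_isQuotient hle
  obtain ⟨e⟩ := (h'.liftSub p).nonempty_iso h
  exact h'.of_iso e

end Quotients

section UpperContinuity

variable {K : Type u} [Category.{v} K]

/-- The diagram of a monotone family of subobjects. -/
noncomputable def subobjectDiagram {J : Type w} [Preorder J] {X : K} (f : J → Subobject X)
    (hf : Monotone f) : J ⥤ K where
  obj j := (f j : K)
  map h := Subobject.ofLE _ _ (hf (leOfHom h))

/-- The cocone on a monotone family of subobjects given by an upper bound. -/
noncomputable def subobjectCocone {J : Type w} [Preorder J] {X : K} (f : J → Subobject X)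
    (hf : Monotone f) (y : Subobject X) (hy : ∀ j, f j ≤ y) :
    Cocone (subobjectDiagram f hf) where
  pt := (y : K)
  ι := { app := fun j => Subobject.ofLE _ _ (hy j)
         naturality := fun i j h => by
          simp [subobjectDiagram] }

variable [Abelian K] [IsGrothendieckAbelian.{v} K]

/-- The join of a directed family of subobjects is its colimit. -/
noncomputable def isColimitSubobjectCocone {J : Type v} [Preorder J] [IsFiltered J] {X : K}
    (f : J → Subobject X) (hf : Monotone f) (y : Subobject X) (hy : ∀ j, f j ≤ y)
    (hy' : y ≤ ⨆ j, f j) :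
    IsColimit (subobjectCocone f hf y hy) := by
  let F : J ⥤ MonoOver X :=
    { obj := fun j => MonoOver.mk (f j).arrow
      map := fun h => MonoOver.homMk (Subobject.ofLE _ _ (hf (leOfHom h))) }
  let c : Cocone (F ⋙ MonoOver.forget X) :=
    { pt := Over.mk y.arrow
      ι := { app := fun j => Over.homMk (Subobject.ofLE _ _ (hy j)) (by simp [F])
             naturality := fun i j h => by
              apply Over.OverMorphism.ext
              change Subobject.ofLE _ _ _ ≫ Subobject.ofLE _ _ _ = Subobject.ofLE _ _ _ ≫ 𝟙 _
              rw [Subobject.ofLE_comp_ofLE, comp_id] } }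
  have hmono : Mono c.pt.hom := inferInstanceAs (Mono y.arrow)
  refine IsGrothendieckAbelian.isColimitMapCoconeOfSubobjectMkEqISup F c ?_
  change Subobject.mk y.arrow = ⨆ j, Subobject.mk (f j).arrow
  simp only [Subobject.mk_arrow]
  exact le_antisymm hy' (iSup_le hy)

lemma mono_iSup_arrow_comp {J : Type v} [Preorder J] [IsFiltered J] {X Y : K}
    (f : J → Subobject X) (hf : Monotone f) (h : X ⟶ Y) (hh : ∀ j, Mono ((f j).arrow ≫ h)) :
    Mono ((⨆ j, f j).arrow ≫ h) := by
  let G : J ⥤ MonoOver Y :=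
    { obj := fun j => MonoOver.mk ((f j).arrow ≫ h)
      map := fun {i j} e => MonoOver.homMk (Subobject.ofLE _ _ (hf (leOfHom e))) (by simp) }
  exact IsGrothendieckAbelian.mono_of_isColimit_monoOver G
    (isColimitSubobjectCocone f hf (⨆ j, f j) (le_iSup f) le_rfl) ((⨆ j, f j).arrow ≫ h)
    (fun j => Subobject.ofLE_arrow_assoc _ h)

lemma upperContinuous_subobject (X : K) : UpperContinuous.{v} (Subobject X) := by
  intro ι f a hf
  cases isEmpty_or_nonempty ι with
  | inl _ => simp
  | inr _ =>
  let : Preorder ι := Preorder.lift f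
  have hmono : Monotone f := fun _ _ h => h
  have : IsDirectedOrder ι := ⟨hf⟩
  have : IsFiltered ι := isFiltered_of_directed_le_nonempty ι
  set N := ⨆ i, a ⊓ f i
  have hN (i) : a ⊓ f i ≤ N := le_iSup (fun i => a ⊓ f i) i
  have hNa : N ≤ a := iSup_le fun i => inf_le_left
  let p := cokernel.π N.arrow
  have hNa' : N.arrow ≫ cokernel.π a.arrow = 0 := by
    rw [← Subobject.ofLE_arrow hNa, assoc, cokernel.condition, comp_zero]
  let h : cokernel N.arrow ⟶ cokernel a.arrow := cokernel.desc N.arrow (cokernel.π a.arrow) hNa'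
  have hp : p ≫ h = cokernel.π a.arrow := cokernel.π_desc _ _ _
  let g (i : ι) := imageOf p (f i)
  have hg : Monotone g := fun i j hij => (gc_imageOf_pullback p).monotone_l (hmono hij)
  have hgmono (i : ι) : Mono ((g i).arrow ≫ h) := by
    refine Preadditive.mono_of_cancel_zero _ fun {W} t ht => ?_
    obtain ⟨W', π, hπ, k, hk, e⟩ := (imageOf_factors_iff p (f i) (t ≫ (g i).arrow)).1
      (factors_comp_arrow t)
    have h1 : k ≫ cokernel.π a.arrow = 0 := by
      rw [← hp, ← assoc, ← e, assoc, assoc, ht, comp_zero]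
    have h2 : k ≫ p = 0 := by
      rw [← factors_iff_comp_cokernel_eq_zero] at h1 ⊢
      exact Subobject.factors_of_le k (hN i) ((Subobject.inf_factors k).2 ⟨h1, hk⟩)
    rw [← cancel_mono (g i).arrow, ← cancel_epi π, e, h2]
    simp
  have hm := mono_iSup_arrow_comp g hg h hgmono
  apply le_of_forall_factors
  intro W k hk
  obtain ⟨hka, hkf⟩ := (Subobject.inf_factors k).1 hk
  have h3 : (⨆ i, g i).Factors (k ≫ p) := by
    have h4 : imageOf p (⨆ i, f i) = ⨆ i, g i := (gc_imageOf_pullback p).l_iSup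
    rw [← h4, imageOf_factors_iff]
    exact ⟨W, 𝟙 W, inferInstance, k, hkf, id_comp _⟩
  rw [factors_iff_comp_cokernel_eq_zero] at hka ⊢
  have h5 : (⨆ i, g i).factorThru _ h3 = 0 := by
    rw [← cancel_mono ((⨆ i, g i).arrow ≫ h)]
    simp [hp, hka]
  rw [← Subobject.factorThru_arrow _ _ h3, h5, zero_comp]

end UpperContinuity

section FactorsLemmas

variable {K : Type u} [Category.{v} K]

lemma mk_factors_self {A X : K} (i : A ⟶ X) [Mono i] : (Subobject.mk i).Factors i :=
  ⟨𝟙 A, id_comp i⟩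

lemma mk_le_of_factors {A X : K} (i : A ⟶ X) [Mono i] {N : Subobject X} (h : N.Factors i) :
    Subobject.mk i ≤ N :=
  Subobject.mk_le_of_comm (N.factorThru i h) (N.factorThru_arrow i h)

variable [Abelian K]

lemma factors_of_isColimit {J : Type w} [Category.{w} J] {F : J ⥤ K} {c : Cocone F}
    (hc : IsColimit c) {X : K} (g : c.pt ⟶ X) (N : Subobject X)
    (h : ∀ j, N.Factors (c.ι.app j ≫ g)) : N.Factors g := by
  rw [factors_iff_comp_cokernel_eq_zero]
  refine hc.hom_ext fun j => ?_
  have := h j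
  rw [factors_iff_comp_cokernel_eq_zero, assoc] at this
  rw [this, comp_zero]

end FactorsLemmas

section Filtrations

variable {K : Type u} [Category.{v} K] [Abelian K] [IsGrothendieckAbelian.{v} K]

/-- The interval from `x` to `y` is exhausted by a well-ordered family of subobjects whose
successive quotients lie in `S`. -/
def HasFiltration (S : Set K) {X : K} (x y : Subobject X) : Prop :=
  ∃ (J : Type v) (_ : LinearOrder J) (_ : WellFoundedLT J) (A : J → Subobject X),
    x ⊔ ⨆ j, A j = y ∧
    ∀ j, ∃ s ∈ S, IsQuotient (x ⊔ partialSup A (Set.Iio j)) (x ⊔ partialSup A (Set.Iic j)) s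

lemma mono_of_chain {J : Type v} [LinearOrder J] [SuccOrder J] [OrderBot J] [WellFoundedLT J]
    (F : J ⥤ K) (c : Cocone F) (hc : IsColimit c)
    (hsucc : ∀ j : J, ¬IsMax j → Mono (F.map (homOfLE (Order.le_succ j))))
    (hlim : ∀ j : J, Order.IsSuccLimit j → Nonempty (IsColimit (coconeLT F j))) :
    (∀ i j (φ : i ⟶ j), Mono (F.map φ)) ∧ ∀ j, Mono (c.ι.app j) := by
  have hF : F.IsWellOrderContinuous := ⟨fun m hm => hlim m hm⟩
  let h : (MorphismProperty.monomorphisms K).TransfiniteCompositionOfShape J (c.ι.app ⊥) :=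
    { F := F
      isoBot := Iso.refl _
      incl := c.ι
      isColimit := hc
      fac := id_comp _
      map_mem := hsucc }
  exact ⟨fun i j φ => h.mem_map φ, fun j => h.mem_incl_app j⟩

open ZeroObject in
lemma hasFiltration_of_mem_filteredBy {S : Set K} {X : K} (hX : X ∈ filteredBy S) :
    HasFiltration S (⊥ : Subobject X) ⊤ := by
  obtain ⟨J, _, _, _, _, F, c, hc, eA, eB, hsucc, hlim, -⟩ := hX
  obtain ⟨hmono, hmono'⟩ := mono_of_chain F c hc (fun j hj => (hsucc j hj).1) hlim
  let i (j : J) : F.obj j ⟶ X := c.ι.app j ≫ eB.hom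
  have hi (j : J) : Mono (i j) := inferInstance
  have hi' {j k : J} (h : j ≤ k) : F.map (homOfLE h) ≫ i k = i j := by
    simp [i]
  let x (j : J) : Subobject X := Subobject.mk (i j)
  have hx : Monotone x := fun j k h => Subobject.mk_le_mk_of_comm _ (hi' h)
  let A (j : {j : J // ¬IsMax j}) : Subobject X := x (Order.succ j)
  have key (j : J) : x j ≤ ⨆ k : {k : {k : J // ¬IsMax k} // (k : J) < j}, A k := by
    by_cases h1 : IsMin j
    · obtain rfl := h1.eq_bot
      have h0 : i ⊥ = 0 := by
        rw [← cancel_epi eA.hom]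
        exact (isZero_zero K).eq_of_src _ _
      have : x ⊥ = ⊥ := Subobject.mk_eq_bot_iff_zero.2 h0
      rw [this]
      exact bot_le
    by_cases h2 : Order.IsSuccLimit j
    · obtain ⟨hl⟩ := hlim j h2
      refine mk_le_of_factors _ (factors_of_isColimit hl (i j) _ fun k => ?_)
      have hk : ¬IsMax (k : J) := not_isMax_of_lt k.2
      have h3 : (coconeLT F j).ι.app k ≫ i j = i k := hi' k.2.le
      rw [h3]
      refine Subobject.factors_of_le _ ?_ (mk_factors_self (i k))
      exact (hx (Order.le_succ (k : J))).trans
        (le_iSup (fun k : {k : {k : J // ¬IsMax k} // (k : J) < j} => A k) ⟨⟨k, hk⟩, k.2⟩)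
    · have h3 : ¬Order.IsSuccPrelimit j := fun h => h2 ⟨h1, h⟩
      obtain ⟨k, hk⟩ : ∃ k, k ⋖ j := by simpa [Order.IsSuccPrelimit] using h3
      have hk' : ¬IsMax k := not_isMax_of_lt hk.lt
      obtain rfl := hk.succ_eq
      exact le_iSup (fun l : {l : {k : J // ¬IsMax k} // (l : J) < Order.succ k} => A l)
        ⟨⟨k, hk'⟩, Order.lt_succ_of_not_isMax hk'⟩
  have hIio (j : {j : J // ¬IsMax j}) : partialSup A (Set.Iio j) = x j := by
    apply le_antisymm
    · exact partialSup_le fun k hk => hx (Order.succ_le_of_lt (show (k : J) < j from hk))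
    · exact (key j).trans (iSup_le fun k => le_partialSup A (show (k : _) < j from k.2))
  have hIic (j : {j : J // ¬IsMax j}) : partialSup A (Set.Iic j) = x (Order.succ (j : J)) := by
    apply le_antisymm
    · exact partialSup_le fun k hk => hx (Order.succ_le_succ (show (k : J) ≤ j from hk))
    · exact le_partialSup A (le_refl j)
  refine ⟨{j : J // ¬IsMax j}, inferInstance, inferInstance, A, ?_, fun j => ?_⟩
  · rw [bot_sup_eq, eq_top_iff]
    have h4 (j : J) : (⨆ j, A j).Factors (c.ι.app j ≫ eB.hom) :=
      Subobject.factors_of_le _ ((key j).trans (iSup_le fun k => le_iSup A k))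
        (mk_factors_self (i j))
    have h5 := factors_of_isColimit hc eB.hom _ h4
    apply le_of_forall_factors
    intro W g _
    have h6 := Subobject.factors_of_factors_right (g ≫ eB.inv) h5
    simpa using h6
  · obtain ⟨-, s, hs, e⟩ := hsucc j j.2
    refine ⟨s, hs, ?_⟩
    rw [bot_sup_eq, bot_sup_eq, hIio, hIic]
    exact (isQuotient_mk_iff _ _ _ (hi' (Order.le_succ (j : J))) s).2 e

open ZeroObject in
lemma mem_filteredBy_of_hasFiltration {S : Set K} {X : K}
    (hX : HasFiltration S (⊥ : Subobject X) ⊤) : X ∈ filteredBy S := by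
  obtain ⟨J, _, _, A, htop, hA⟩ := hX
  rw [bot_sup_eq] at htop
  obtain ⟨_⟩ : Nonempty (SuccOrder (WithTop J)) := ⟨SuccOrder.ofLinearWellFoundedLT _⟩
  obtain ⟨_⟩ : Nonempty (OrderBot (WithTop J)) := ⟨WellFoundedLT.toOrderBot _⟩
  let x (t : WithTop J) : Subobject X := partialSup A {j | (j : WithTop J) < t}
  have hx : Monotone x := fun s t h => partialSup_mono A fun j hj => lt_of_lt_of_le hj h
  have hxbot : x ⊥ = ⊥ := by
    rw [eq_bot_iff]
    exact partialSup_le fun j (hj : (j : WithTop J) < ⊥) => (not_lt_bot hj).elim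
  have hxtop : x ⊤ = ⊤ := by
    rw [eq_top_iff, ← htop]
    exact iSup_le fun j => le_partialSup A (WithTop.coe_lt_top j)
  have hxj (j : J) : x j = partialSup A (Set.Iio j) :=
    congrArg (partialSup A) (Set.ext fun k => WithTop.coe_lt_coe)
  have hxsucc (j : J) : x (Order.succ (j : WithTop J)) = partialSup A (Set.Iic j) :=
    congrArg (partialSup A) (Set.ext fun k =>
      (Order.lt_succ_iff_of_not_isMax (not_isMax_of_lt (WithTop.coe_lt_top j))).trans
        WithTop.coe_le_coe)
  have h0 : ((⊥ : Subobject X) : K) ≅ 0 := Subobject.botCoeIsoZero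
  have : IsIso (⊤ : Subobject X).arrow := (Subobject.isIso_arrow_iff_eq_top _).2 rfl
  have e1 : ((⊤ : Subobject X) : K) ≅ X := asIso (⊤ : Subobject X).arrow
  refine ⟨WithTop J, inferInstance, inferInstance, inferInstance, inferInstance,
    subobjectDiagram x hx, subobjectCocone x hx ⊤ (fun _ => le_top),
    isColimitSubobjectCocone x hx ⊤ _ (by rw [← hxtop]; exact le_iSup x ⊤),
    h0.symm ≪≫ eqToIso (by rw [← hxbot]; rfl), e1, ?_, ?_,
    (isZero_zero K).eq_of_src _ _⟩
  · intro t ht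
    obtain ⟨j, rfl⟩ := WithTop.ne_top_iff_exists.1 (fun h : t = ⊤ => ht (h ▸ isMax_top))
    obtain ⟨s, hs, h⟩ := hA j
    rw [bot_sup_eq, bot_sup_eq, ← hxj, ← hxsucc] at h
    exact ⟨inferInstanceAs (Mono (Subobject.ofLE _ _ _)), s, hs, (isQuotient_iff h.1 s).1 h⟩
  · intro t ht
    have : Nonempty {i // i < t} := by
      obtain ⟨s, hs⟩ := not_isMin_iff.1 ht.1
      exact ⟨⟨s, hs⟩⟩
    have : IsFiltered {i // i < t} := isFiltered_of_directed_le_nonempty _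
    refine ⟨isColimitSubobjectCocone (fun i : {i // i < t} => x i)
      (fun _ _ h => hx h) (x t) (fun i => hx i.2.le) ?_⟩
    refine partialSup_le fun j hj => ?_
    have h1 : A j ≤ x (Order.succ (j : WithTop J)) := by
      rw [hxsucc]
      exact le_partialSup A (le_refl j)
    exact h1.trans (le_iSup (fun i : {i // i < t} => x i)
      ⟨Order.succ (j : WithTop J), ht.2.succ_lt hj⟩)

end Filtrations

section LiftSub

variable {K : Type u} [Category.{v} K] [Abelian K]

lemma le_liftSub {X Q : K} {x y : Subobject X} (hxy : x ≤ y) (p : (y : K) ⟶ Q)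
    (hp : ∀ ⦃W : K⦄ (g : W ⟶ (y : K)), g ≫ p = 0 ↔ x.Factors (g ≫ y.arrow))
    (Z : Subobject Q) : x ≤ liftSub p Z :=
  le_of_forall_factors fun W g hg => by
    have hg' := Subobject.factors_of_le g hxy hg
    refine (liftSub_factors_iff _ _ _).2 ⟨y.factorThru g hg', by simp, ?_⟩
    have : y.factorThru g hg' ≫ p = 0 := (hp _).2 (by simpa using hg)
    rw [this]
    exact Subobject.factors_zero

lemma liftSub_top {X Q : K} {y : Subobject X} (p : (y : K) ⟶ Q) : liftSub p ⊤ = y :=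
  le_antisymm (liftSub_le _ _) (le_of_forall_factors fun W g hg =>
    (liftSub_factors_iff _ _ _).2 ⟨y.factorThru g hg, by simp, Subobject.top_factors _⟩)

lemma mem_filteredBy_of_iso {S : Set K} {X Y : K} (e : X ≅ Y) (hX : X ∈ filteredBy S) :
    Y ∈ filteredBy S := by
  obtain ⟨J, _, _, _, _, F, c, hc, eA, eB, hsucc, hlim, h⟩ := hX
  refine ⟨J, inferInstance, inferInstance, inferInstance, inferInstance, F, c, hc, eA, eB ≪≫ e,
    hsucc, hlim, ?_⟩
  rw [Iso.trans_hom, ← assoc (c.ι.app ⊥), ← assoc, h, zero_comp]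

end LiftSub

section FiltrationTransfer

lemma partialSup_union {L : Type*} [CompleteLattice L] {J : Type v} (A : J → L) (I I' : Set J) :
    partialSup A (I ∪ I') = partialSup A I ⊔ partialSup A I' :=
  iSup_union

lemma partialSup_univ {L : Type*} [CompleteLattice L] {J : Type v} (A : J → L) :
    partialSup A Set.univ = ⨆ j, A j :=
  iSup_univ

lemma partialSup_Iic {L : Type*} [CompleteLattice L] {J : Type v} [LinearOrder J] (A : J → L)
    (j : J) : partialSup A (Set.Iic j) = partialSup A (Set.Iio j) ⊔ A j := by
  rw [← Set.Iio_union_right, partialSup_union]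
  simp [partialSup]

lemma sigmaLex_iff_exists {ι : Type*} {α : ι → Type*} {r : ι → ι → Prop}
    {s : ∀ i, α i → α i → Prop} {i j : ι} {l : α i} {k : α j} :
    Sigma.Lex r s ⟨i, l⟩ ⟨j, k⟩ ↔
      r i j ∨ ∃ l', s j l' k ∧ (⟨i, l⟩ : Σ i, α i) = ⟨j, l'⟩ := by
  constructor
  · rintro (h | h)
    · exact Or.inl ‹_›
    · exact Or.inr ⟨_, ‹_›, rfl⟩
  · rintro (h | ⟨l, h, h'⟩)
    · exact Sigma.Lex.left _ _ h
    · cases h'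
      exact Sigma.Lex.right _ _ h

instance wellFoundedLT_sigmaLex {ι : Type*} {α : ι → Type*} [LT ι] [∀ i, LT (α i)]
    [WellFoundedLT ι] [∀ i, WellFoundedLT (α i)] : WellFoundedLT (Σₗ i, α i) := by
  refine ⟨⟨?_⟩⟩
  have key (i : ι) (a : α i) : Acc (fun x y : Σₗ i, α i => x < y) (toLex ⟨i, a⟩) := by
    induction i using WellFoundedLT.induction with
    | _ i ih =>
      induction a using WellFoundedLT.induction with
      | _ a ih' =>
        refine ⟨_, fun ⟨k, b⟩ hb => ?_⟩
        cases hb with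
        | left _ _ h => exact ih k h b
        | right _ _ h => exact ih' b h
  exact fun ⟨i, a⟩ => key i a

variable {K : Type u} [Category.{v} K] [Abelian K] [IsGrothendieckAbelian.{v} K]

lemma HasFiltration.mono {S S' : Set K} (h : S ⊆ S') {X : K} {x y : Subobject X}
    (hxy : HasFiltration S x y) : HasFiltration S' x y := by
  obtain ⟨J, i₁, i₂, A, hA, hA'⟩ := hxy
  exact ⟨J, i₁, i₂, A, hA, fun j => (hA' j).imp fun s hs => ⟨h hs.1, hs.2⟩⟩

lemma liftSub_partialSup {X Q : K} {x y : Subobject X} (hxy : x ≤ y) (p : (y : K) ⟶ Q) [Epi p]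
    (hp : ∀ ⦃W : K⦄ (g : W ⟶ (y : K)), g ≫ p = 0 ↔ x.Factors (g ≫ y.arrow))
    {J : Type v} (B : J → Subobject Q) (I : Set J) :
    liftSub p (partialSup B I) = x ⊔ partialSup (fun j => liftSub p (B j)) I := by
  set w := x ⊔ partialSup (fun j => liftSub p (B j)) I with hw
  have hwy : w ≤ y := sup_le hxy (partialSup_le fun j _ => liftSub_le _ _)
  apply le_antisymm
  · refine (liftSub_mono p (partialSup_le fun j hj => ?_)).trans
      (liftSub_descSub p hp (le_sup_left : x ≤ w) hwy).le
    rw [← descSub_liftSub p (B j)]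
    exact descSub_mono p ((le_partialSup (fun j => liftSub p (B j)) hj).trans le_sup_right)
  · exact sup_le (le_liftSub hxy p hp _)
      (partialSup_le fun j hj => liftSub_mono p (le_partialSup B hj))

lemma hasFiltration_iff_of_isQuotient {S : Set K} {X Q : K} {x y : Subobject X}
    (h : IsQuotient x y Q) : HasFiltration S x y ↔ HasFiltration S (⊥ : Subobject Q) ⊤ := by
  obtain ⟨hxy, p, _, hp⟩ := h
  constructor
  · rintro ⟨J, i₁, i₂, A, hA, hA'⟩
    have hle (j : J) : x ⊔ A j ≤ y := hA ▸ sup_le_sup_left (le_iSup A j) x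
    let B (j : J) : Subobject Q := descSub p (x ⊔ A j)
    have key (I : Set J) : liftSub p (partialSup B I) = x ⊔ partialSup A I := by
      rw [liftSub_partialSup hxy p hp]
      have : (fun j => liftSub p (B j)) = fun j => x ⊔ A j :=
        funext fun j => liftSub_descSub p hp le_sup_left (hle j)
      rw [this]
      apply le_antisymm
      · exact sup_le le_sup_left (partialSup_le fun j hj =>
          sup_le_sup_left (le_partialSup A hj) x)
      · exact sup_le_sup_left (partialSup_le fun j hj =>
          le_sup_right.trans (le_partialSup (fun j => x ⊔ A j) hj)) x
    refine ⟨J, i₁, i₂, B, ?_, fun j => ?_⟩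
    · rw [bot_sup_eq, ← partialSup_univ, ← descSub_liftSub p (partialSup B _), key,
        partialSup_univ, hA, ← descSub_liftSub p ⊤, liftSub_top]
    · obtain ⟨s, hs, h⟩ := hA' j
      refine ⟨s, hs, ?_⟩
      rw [← key, ← key] at h
      rw [bot_sup_eq, bot_sup_eq]
      exact h.of_liftSub
  · rintro ⟨J, i₁, i₂, B, hB, hB'⟩
    refine ⟨J, i₁, i₂, fun j => liftSub p (B j), ?_, fun j => ?_⟩
    · rw [← partialSup_univ, ← liftSub_partialSup hxy p hp, partialSup_univ]
      rw [bot_sup_eq] at hB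
      rw [hB, liftSub_top]
    · obtain ⟨s, hs, h⟩ := hB' j
      refine ⟨s, hs, ?_⟩
      rw [← liftSub_partialSup hxy p hp, ← liftSub_partialSup hxy p hp]
      rw [bot_sup_eq, bot_sup_eq] at h
      exact h.liftSub p

/-- Filtrations of the successive quotients of a filtration assemble to a filtration. -/
lemma hasFiltration_of_filteredBy {S : Set K} {X : K} {x y : Subobject X}
    (h : HasFiltration (filteredBy S) x y) : HasFiltration S x y := by
  obtain ⟨J, i₁, i₂, A, hA, hA'⟩ := h
  have (j : J) : HasFiltration S (x ⊔ partialSup A (Set.Iio j)) (x ⊔ partialSup A (Set.Iic j)) := by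
    obtain ⟨s, hs, h⟩ := hA' j
    exact (hasFiltration_iff_of_isQuotient h).2 (hasFiltration_of_mem_filteredBy hs)
  choose I j₁ j₂ B hB hB' using this
  let C (p : Σₗ j, I j) : Subobject X := B (ofLex p).1 (ofLex p).2
  have key {D : Set J} (hD : IsLowerSet D) :
      x ⊔ partialSup C {p | (ofLex p).1 ∈ D} = x ⊔ partialSup A D := by
    apply le_antisymm
    · refine sup_le le_sup_left (partialSup_le ?_)
      rintro ⟨j, k⟩ (hj : j ∈ D)
      refine (le_iSup (B j) k).trans (le_sup_right.trans ((hB j).le.trans ?_))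
      exact sup_le_sup_left (partialSup_mono A fun i hi => hD hi hj) x
    · refine sup_le le_sup_left (partialSup_le fun j hj => ?_)
      induction j using WellFoundedLT.induction with
      | _ j ih =>
        have h1 : A j ≤ x ⊔ partialSup A (Set.Iic j) :=
          (le_partialSup A (Set.mem_Iic.2 le_rfl)).trans le_sup_right
        refine h1.trans ((hB j).ge.trans (sup_le (sup_le le_sup_left ?_) ?_))
        · exact partialSup_le fun i hi => ih i hi (hD (le_of_lt hi) hj)
        · exact iSup_le fun k => le_trans
            (le_partialSup C (show (toLex ⟨j, k⟩ : Σₗ j, I j) ∈ {p | (ofLex p).1 ∈ D} from hj))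
            le_sup_right
  have key' (j : J) (D : Set (I j)) :
      x ⊔ partialSup C ({p | (ofLex p).1 ∈ Set.Iio j} ∪ {p | ∃ k ∈ D, p = toLex ⟨j, k⟩}) =
        (x ⊔ partialSup A (Set.Iio j)) ⊔ partialSup (B j) D := by
    rw [partialSup_union, ← sup_assoc, key (isLowerSet_Iio j)]
    congr 1
    apply le_antisymm
    · refine partialSup_le ?_
      rintro _ ⟨k, hk, rfl⟩
      exact le_partialSup (B j) hk
    · exact partialSup_le fun k hk => le_partialSup C
        (show toLex ⟨j, k⟩ ∈ {p | ∃ k ∈ D, p = toLex ⟨j, k⟩} from ⟨k, hk, rfl⟩)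
  refine ⟨Σₗ j, I j, inferInstance, inferInstance, C, ?_, fun ⟨j, k⟩ => ?_⟩
  · have := key isLowerSet_univ
    rw [partialSup_univ, hA] at this
    rw [← this, ← partialSup_univ]
    rfl
  · have h1 : Set.Iio (toLex ⟨j, k⟩ : Σₗ j, I j) =
        {p | (ofLex p).1 ∈ Set.Iio j} ∪ {p | ∃ l ∈ Set.Iio k, p = toLex ⟨j, l⟩} := by
      ext ⟨i, l⟩
      exact sigmaLex_iff_exists
    have h2 : Set.Iic (toLex ⟨j, k⟩ : Σₗ j, I j) =
        {p | (ofLex p).1 ∈ Set.Iio j} ∪ {p | ∃ l ∈ Set.Iic k, p = toLex ⟨j, l⟩} := by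
      ext ⟨i, l⟩
      exact sigmaLex_iff_exists
    obtain ⟨s, hs, h⟩ := hB' j k
    refine ⟨s, hs, ?_⟩
    rw [← key', ← key', ← h1, ← h2] at h
    exact h

/-- The Hill lemma: closed index sets cut out filtered intervals. -/
lemma HillClosed.hasFiltration {S : Set K} {X : K} {J : Type v} [LinearOrder J]
    [WellFoundedLT J] {A : J → Subobject X}
    (hA : ∀ j, ∃ s ∈ S, IsQuotient (partialSup A (Set.Iio j)) (partialSup A (Set.Iic j)) s)
    {I I' : Set J} (hI : HillClosed A I) (hI' : HillClosed A I') (hII' : I ⊆ I') :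
    HasFiltration S (partialSup A I) (partialSup A I') := by
  let J' := {j : J // j ∈ I' ∧ j ∉ I}
  have key (D : Set J) : partialSup A I ⊔ partialSup (fun j : J' => A j) {j | (j : J) ∈ D} =
      partialSup A (I ∪ I' ∩ D) := by
    apply le_antisymm
    · exact sup_le (partialSup_mono A Set.subset_union_left)
        (partialSup_le fun j hj => le_partialSup A (Or.inr ⟨j.2.1, hj⟩))
    · refine partialSup_le fun j hj => ?_
      by_cases hjI : j ∈ I
      · exact (le_partialSup A hjI).trans le_sup_left
      · obtain hj | hj := hj
        · exact (hjI hj).elim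
        · exact (le_partialSup (fun j : J' => A j) (j := ⟨j, hj.1, hjI⟩)
            (show j ∈ D from hj.2)).trans le_sup_right
  refine ⟨J', inferInstance, inferInstance, fun j => A j, ?_, fun j => ?_⟩
  · have := key Set.univ
    rw [Set.inter_univ, Set.union_eq_self_of_subset_left hII'] at this
    rw [← this, ← partialSup_univ]
    rfl
  · obtain ⟨s, hs, h⟩ := hA j
    refine ⟨s, hs, ?_⟩
    have h1 := key (Set.Iio (j : J))
    have h2 := key (Set.Iic (j : J))
    have h3 : I ∪ I' ∩ Set.Iic (j : J) = (I ∪ I' ∩ Set.Iio (j : J)) ∪ {(j : J)} := by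
      rw [← Set.Iio_union_right, Set.inter_union_distrib_left, Set.union_assoc,
        Set.inter_singleton_of_mem j.2.1]
    have h4 : partialSup A {(j : J)} = A j := by simp [partialSup]
    change IsQuotient (_ ⊔ partialSup _ {k : J' | (k : J) ∈ Set.Iio (j : J)})
      (_ ⊔ partialSup _ {k : J' | (k : J) ∈ Set.Iic (j : J)}) s
    rw [h1, h2, h3, partialSup_union A (I ∪ I' ∩ Set.Iio (j : J)) {(j : J)}, h4, isQuotient_sup_iff]
    rw [partialSup_Iic, isQuotient_sup_iff] at h
    have hK := hI.union_inter_of_subset hI' (isLowerSet_Iio (j : J))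
    convert h using 1
    apply le_antisymm
    · refine le_inf ?_ inf_le_right
      refine (inf_le_inf_left _ (le_partialSup A (Set.mem_Iic.2 (le_refl (j : J))))).trans
        ((hK.partialSup_inf_le (upperContinuous_subobject X) (isLowerSet_Iic (j : J))).trans
          (partialSup_mono A ?_))
      rintro k ⟨hk | hk, hkj⟩
      · exact lt_of_le_of_ne hkj fun e => j.2.2 (e ▸ hk)
      · exact hk.2
    · refine le_inf ?_ inf_le_right
      rw [inf_comm]
      exact (hI' j j.2.1).trans (partialSup_mono A Set.subset_union_right)

end FiltrationTransfer

section Generation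

variable {K : Type u} [Category.{v} K] [Abelian K]

lemma le_of_isSeparator {G X : K} (hG : IsSeparator G) {x y : Subobject X}
    (h : ∀ g : G ⟶ X, x.Factors g → y.Factors g) : x ≤ y := by
  apply le_of_forall_factors
  intro W g hg
  rw [factors_iff_comp_cokernel_eq_zero]
  refine (isSeparator_def G).1 hG _ _ fun k => ?_
  rw [comp_zero, ← assoc, ← factors_iff_comp_cokernel_eq_zero]
  exact h _ (Subobject.factors_of_factors_right k hg)

/-- `a` is generated by the images of fewer than `κ` morphisms from `G`. -/
def IsGeneratedLT [IsGrothendieckAbelian.{v} K] (κ : Cardinal.{v}) (G : K) {X : K}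
    (a : Subobject X) : Prop :=
  ∃ D : Set (G ⟶ X), Cardinal.mk D < κ ∧ a = ⨆ g ∈ D, imageSubobject g

variable [IsGrothendieckAbelian.{v} K]

lemma isSmallElement_imageSubobject {κ : Cardinal.{v}} {X Y : K} (f : Y ⟶ X)
    (hY : Cardinal.mk (Shrink.{v} (Subobject Y)) < κ) :
    IsSmallElement κ (imageSubobject f) := by
  refine isSmallElement_of_injOn hY
    (fun z => equivShrink _ ((Subobject.pullback f).obj z)) fun z hz z' hz' h => ?_
  have key {z z' : Subobject X} (hz : z ≤ imageSubobject f)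
      (h : (Subobject.pullback f).obj z = (Subobject.pullback f).obj z') : z ≤ z' := by
    refine le_of_forall_factors fun W g hg => ?_
    obtain ⟨W', π, hπ, k, e⟩ := (imageSubobject_factors_iff f g).1
      (Subobject.factors_of_le g hz hg)
    apply factors_of_epi_comp _ π
    rw [e, ← Limits.pullback_factors_iff, ← h, Limits.pullback_factors_iff, ← e]
    exact Subobject.factors_of_factors_right π hg
  have h' := (equivShrink _).injective h
  exact le_antisymm (key hz h') (key hz' h'.symm)

lemma IsGeneratedLT.isSmallElement {κ : Cardinal.{v}} (hκ : κ.IsRegular)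
    (hκ' : Cardinal.aleph0 < κ) {G X : K} (hG : Cardinal.mk (Shrink.{v} (Subobject G)) < κ)
    {a : Subobject X} (ha : IsGeneratedLT κ G a) : IsSmallElement κ a := by
  obtain ⟨D, hD, rfl⟩ := ha
  rw [iSup_subtype']
  exact IsSmallElement.iSup hκ hκ' (upperContinuous_subobject X) hD
    fun g => isSmallElement_imageSubobject _ hG

lemma IsGeneratedLT.iSup {κ : Cardinal.{v}} (hκ : κ.IsRegular) {G X : K} {σ : Type v}
    (hσ : Cardinal.mk σ < κ) {a : σ → Subobject X} (ha : ∀ i, IsGeneratedLT κ G (a i)) :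
    IsGeneratedLT κ G (⨆ i, a i) := by
  choose D hD h using ha
  refine ⟨⋃ i, D i, (Cardinal.card_iUnion_lt_iff_forall_of_isRegular hκ hσ).2 hD, ?_⟩
  rw [iSup_iUnion]
  exact iSup_congr h

lemma IsGeneratedLT.partialSup {κ : Cardinal.{v}} (hκ : κ.IsRegular) {G X : K} {J : Type v}
    {A : J → Subobject X} (hA : ∀ j, IsGeneratedLT κ G (A j)) {I : Set J}
    (hI : Cardinal.mk I < κ) : IsGeneratedLT κ G (partialSup A I) := by
  rw [CellularPaper.partialSup, iSup_subtype']
  exact IsGeneratedLT.iSup hκ hI fun j => hA j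

/-- A small quotient is covered by a small subobject. -/
lemma IsQuotient.exists_isGeneratedLT {κ : Cardinal.{v}} {G X s : K} (hG : IsSeparator G)
    {x y : Subobject X} (h : IsQuotient x y s)
    (hs : Cardinal.mk (Shrink.{v} (Subobject s)) < κ) :
    ∃ a ≤ y, IsGeneratedLT κ G a ∧ y ≤ x ⊔ a := by
  classical
  obtain ⟨hxy, p, _, hp⟩ := h
  let r (Z : Shrink.{v} (Subobject s)) : G ⟶ (y : K) :=
    if h : ∃ h : G ⟶ (y : K), imageSubobject (h ≫ p) = (equivShrink _).symm Z then h.choose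
      else 0
  have hr (h : G ⟶ (y : K)) :
      imageSubobject (r (equivShrink _ (imageSubobject (h ≫ p))) ≫ p) =
        imageSubobject (h ≫ p) := by
    have h1 : ∃ h' : G ⟶ (y : K), imageSubobject (h' ≫ p) =
        (equivShrink _).symm (equivShrink _ (imageSubobject (h ≫ p))) := ⟨h, by simp⟩
    have h2 := h1.choose_spec.trans (Equiv.symm_apply_apply _ _)
    exact (congrArg (fun t => imageSubobject (t ≫ p)) (dif_pos h1)).trans h2
  let D : Set (G ⟶ X) := Set.range fun Z => r Z ≫ y.arrow
  refine ⟨⨆ g ∈ D, imageSubobject g, ?_, ⟨D, Cardinal.mk_range_le.trans_lt hs, rfl⟩, ?_⟩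
  · refine iSup₂_le ?_
    rintro _ ⟨Z, rfl⟩
    exact (imageSubobject_le_iff_factors _ _).2 (factors_comp_arrow _)
  · refine le_of_isSeparator hG fun g hg => ?_
    obtain ⟨h, rfl⟩ : ∃ h, h ≫ y.arrow = g := ⟨_, y.factorThru_arrow g hg⟩
    set h' := r (equivShrink _ (imageSubobject (h ≫ p)))
    have h3 : (imageSubobject (h' ≫ p)).Factors (h ≫ p) := by
      rw [hr]
      exact (imageSubobject_le_iff_factors _ _).1 le_rfl
    obtain ⟨W, π, hπ, k, e⟩ := (imageSubobject_factors_iff _ _).1 h3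
    apply factors_of_epi_comp _ π
    rw [sup_factors_iff]
    refine ⟨W, 𝟙 W, inferInstance, (π ≫ h - k ≫ h') ≫ y.arrow, k ≫ h' ≫ y.arrow, ?_, ?_, ?_⟩
    · rw [← hp, Preadditive.sub_comp, assoc, e, assoc, sub_self]
    · refine Subobject.factors_of_factors_right k (Subobject.factors_of_le _
        (le_biSup (fun g => imageSubobject g) ⟨_, rfl⟩)
        ((imageSubobject_le_iff_factors _ _).1 le_rfl))
    · simp [Preadditive.sub_comp]

lemma IsGeneratedLT.exists_epi {κ : Cardinal.{v}} {G X : K} {a : Subobject X}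
    (ha : IsGeneratedLT κ G a) {Λ : Type v} (hΛ : κ ≤ Cardinal.mk Λ) :
    ∃ q : (∐ fun _ : Λ => G) ⟶ (a : K), Epi q := by
  classical
  obtain ⟨D, hD, rfl⟩ := ha
  set a := ⨆ g ∈ D, imageSubobject g
  obtain ⟨i⟩ : Nonempty (D ↪ Λ) := (hD.le.trans hΛ)
  let φ (l : Λ) : G ⟶ (a : K) :=
    if h : ∃ d : D, i d = l then a.factorThru h.choose.1 (Subobject.factors_of_le _
        (le_biSup (fun g => imageSubobject g) h.choose.2)
        ((imageSubobject_le_iff_factors _ _).1 le_rfl)) else 0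
  have hφ (d : D) : φ (i d) ≫ a.arrow = d := by
    have h : ∃ d' : D, i d' = i d := ⟨d, rfl⟩
    simp only [φ]
    rw [dif_pos h, Subobject.factorThru_arrow, i.injective h.choose_spec]
  refine ⟨Sigma.desc φ, ?_⟩
  have h1 : a ≤ imageSubobject (Sigma.desc φ ≫ a.arrow) := by
    refine iSup₂_le fun g hg => ?_
    rw [imageSubobject_le_iff_factors, imageSubobject_factors_iff]
    refine ⟨G, 𝟙 G, inferInstance, Sigma.ι (fun _ : Λ => G) (i ⟨g, hg⟩), ?_⟩
    rw [Sigma.ι_desc_assoc, hφ, id_comp]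
  obtain ⟨W, π, hπ, k, e⟩ := (imageSubobject_factors_iff _ a.arrow).1
    (Subobject.factors_of_le _ h1 (by simpa using factors_comp_arrow (𝟙 (a : K))))
  rw [← assoc, cancel_mono] at e
  exact epi_of_epi_fac e.symm

end Generation

section ClosedFiltrations

variable {K : Type u} [Category.{v} K] [Abelian K] [IsGrothendieckAbelian.{v} K]

lemma exists_generated_filtration {κ : Cardinal.{v}} {G X : K} (hG : IsSeparator G) {S : Set K}
    (hS : ∀ s ∈ S, Cardinal.mk (Shrink.{v} (Subobject s)) < κ) (hX : X ∈ filteredBy S) :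
    ∃ (J : Type v) (_ : LinearOrder J) (_ : WellFoundedLT J) (A : J → Subobject X),
      ⨆ j, A j = ⊤ ∧ (∀ j, IsGeneratedLT κ G (A j)) ∧
      ∀ j, ∃ s ∈ S, IsQuotient (partialSup A (Set.Iio j)) (partialSup A (Set.Iic j)) s := by
  obtain ⟨J, i₁, i₂, A, hA, hA'⟩ := hasFiltration_of_mem_filteredBy hX
  simp only [bot_sup_eq] at hA hA'
  have key (j : J) : ∃ a ≤ A j, IsGeneratedLT κ G a ∧
      A j ≤ partialSup A (Set.Iio j) ⊓ A j ⊔ a := by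
    obtain ⟨s, hs, h⟩ := hA' j
    rw [partialSup_Iic, isQuotient_sup_iff] at h
    exact h.exists_isGeneratedLT hG (hS s hs)
  choose A' h1 h2 h3 using key
  have h4 {D : Set J} (hD : IsLowerSet D) : partialSup A' D = partialSup A D :=
    partialSup_eq_of_sup_eq h1 (fun j => (h3 j).trans (sup_le_sup_right inf_le_left _)) hD
  refine ⟨J, i₁, i₂, A', ?_, h2, fun j => ?_⟩
  · rw [← partialSup_univ, h4 isLowerSet_univ, partialSup_univ, hA]
  · rw [h4 (isLowerSet_Iio j), h4 (isLowerSet_Iic j)]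
    exact hA' j

/-- A filtered object has a filtration by small subobjects closed under a given
join-preserving operator. -/
lemma exists_closed_filtration {κ : Cardinal.{v}} (hκ : κ.IsRegular)
    (hκ' : Cardinal.aleph0 < κ) {G X : K} (hG : IsSeparator G)
    (hG' : Cardinal.mk (Shrink.{v} (Subobject G)) < κ) {S : Set K}
    (hS : ∀ s ∈ S, Cardinal.mk (Shrink.{v} (Subobject s)) < κ) (hX : X ∈ filteredBy S)
    (cl : Subobject X → Subobject X)
    (hcl : ∀ {ι : Type v} (f : ι → Subobject X), cl (⨆ i, f i) ≤ ⨆ i, cl (f i))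
    (hcl' : ∀ a, IsGeneratedLT κ G a → IsSmallElement κ (cl a)) :
    ∃ (J : Type v) (_ : LinearOrder J) (_ : WellFoundedLT J) (B : J → Subobject X),
      ⨆ j, B j = ⊤ ∧ (∀ j, IsGeneratedLT κ G (B j)) ∧ (∀ j, cl (B j) ≤ B j) ∧
      ∀ j, ∃ s ∈ filteredBy S,
        IsQuotient (partialSup B (Set.Iio j)) (partialSup B (Set.Iic j)) s := by
  obtain ⟨J, i₁, i₂, A, hA, hA', hA''⟩ := exists_generated_filtration hG hS hX
  have hL : UpperContinuous.{v} (Subobject X) := upperContinuous_subobject X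
  have hsmall (j : J) : ∃ E : Set J, Cardinal.mk E < κ ∧
      A j ⊓ partialSup A (Set.Iio j) ≤ partialSup A (E ∩ Set.Iio j) ∧
      cl (A j) ≤ partialSup A E := by
    obtain ⟨D, hD, h1⟩ := (((hA' j).isSmallElement hκ hκ' hG').mono
      (inf_le_left : A j ⊓ partialSup A (Set.Iio j) ≤ A j)).exists_le_partialSup hκ hL
      (fun i : Set.Iio j => A i) (inf_le_right.trans (by rw [partialSup, iSup_subtype']))
    obtain ⟨D', hD', h2⟩ := (hcl' _ (hA' j)).exists_le_partialSup hκ hL A (hA ▸ le_top)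
    refine ⟨Set.image Subtype.val D ∪ D', ?_, ?_,
      h2.trans (partialSup_mono A Set.subset_union_right)⟩
    · exact (Cardinal.mk_union_le _ _).trans_lt
        (Cardinal.add_lt_of_lt hκ.aleph0_le (Cardinal.mk_image_le.trans_lt hD) hD')
    · exact h1.trans (partialSup_le fun i hi =>
        le_partialSup A ⟨Or.inl ⟨i, hi, rfl⟩, i.2⟩)
  choose E hE hE₁ hE₂ using hsmall
  have hill {I : Set J} (hI : ∀ i ∈ I, E i ⊆ I) : HillClosed A I := fun j hj =>
    (hE₁ j).trans (partialSup_mono A (Set.inter_subset_inter_left _ (hI j hj)))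
  choose I hI hI' hI₂ using exists_small_closure hκ hκ' E hE
  have hU (D : Set J) : ∀ i ∈ ⋃ j ∈ D, I j, E i ⊆ ⋃ j ∈ D, I j := by
    intro i hi
    obtain ⟨j, hj, hij⟩ := Set.mem_iUnion₂.1 hi
    exact (hI₂ j i hij).trans (Set.subset_biUnion_of_mem hj)
  let B (j : J) : Subobject X := partialSup A (I j)
  have hB (D : Set J) : partialSup B D = partialSup A (⋃ j ∈ D, I j) := by
    simp only [partialSup, B, iSup_iUnion]
  refine ⟨J, i₁, i₂, B, ?_, fun j => IsGeneratedLT.partialSup hκ hA' (hI' j), fun j => ?_,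
    fun j => ?_⟩
  · rw [eq_top_iff, ← hA]
    exact iSup_mono fun j => le_partialSup A (hI j)
  · have h1 : B j = ⨆ i : I j, A i := by
      simp only [B, partialSup, iSup_subtype']
    rw [h1]
    refine (hcl _).trans (iSup_le fun i => (hE₂ i).trans ?_)
    rw [← h1]
    exact partialSup_mono A (hI₂ j i i.2)
  · have hle : partialSup B (Set.Iio j) ≤ partialSup B (Set.Iic j) :=
      partialSup_mono B fun _ h => le_of_lt h
    obtain ⟨s, hs⟩ := exists_isQuotient hle
    refine ⟨s, mem_filteredBy_of_hasFiltration
      ((hasFiltration_iff_of_isQuotient hs).1 ?_), hs⟩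
    rw [hB, hB]
    exact HillClosed.hasFiltration hA'' (hill (hU _)) (hill (hU _))
      (Set.biUnion_subset_biUnion_left fun _ h => le_of_lt h)

end ClosedFiltrations

lemma additive_of_preservesColimits {K : Type u} [Category.{v} K] [Abelian K] {L : Type u'}
    [Category.{v} L] [Abelian L] (F : K ⥤ L) [PreservesColimits F] : F.Additive := by
  have := preservesBinaryBiproducts_of_preservesBinaryCoproducts F
  exact Functor.additive_of_preservesBinaryBiproducts _

section AlgebraCategory

variable {K : Type u} [Category.{v} K] [Abelian K] (T : Monad K)

/-- The category of algebras over a right exact additive monad is abelian. -/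
@[reducible]
noncomputable def algebraAbelian [(T : K ⥤ K).Additive] [PreservesFiniteColimits (T : K ⥤ K)] :
    Abelian T.Algebra := by
  have hL (J : Type) [SmallCategory J] [FinCategory J] : HasLimitsOfShape J T.Algebra :=
    hasLimitsOfShape_of_hasLimitsOfShape_createsLimitsOfShape T.forget
  have hC (J : Type) [SmallCategory J] [FinCategory J] : HasColimitsOfShape J T.Algebra :=
    ⟨fun D => Monad.forget_creates_colimits_of_monad_preserves D⟩
  have : HasFiniteProducts T.Algebra := ⟨fun n => inferInstance⟩
  have : HasKernels T.Algebra := ⟨inferInstance⟩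
  have : HasCokernels T.Algebra := ⟨inferInstance⟩
  have {X Y : T.Algebra} (f : X ⟶ Y) : IsIso (Abelian.coimageImageComparison f) := by
    let e := Abelian.PreservesCoimageImageComparison.iso T.forget f
    have : IsIso (T.forget.map (Abelian.coimageImageComparison f)) := by
      have := (Arrow.isIso_iff_isIso_of_isIso e.hom).2
        (inferInstanceAs (IsIso (Abelian.coimageImageComparison _)))
      exact this
    exact isIso_of_reflects_iso _ T.forget
  exact Abelian.ofCoimageImageComparisonIsIso

end AlgebraCategory

section AlgebraGenerators

variable {K : Type u} [Category.{v} K] (T : Monad K)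

lemma isSeparator_free {G : K} (hG : IsSeparator G) : IsSeparator (T.free.obj G) := by
  refine (isSeparator_def _).2 fun X Y f g h => T.forget.map_injective ?_
  refine (isSeparator_def _).1 hG _ _ fun k => ?_
  have := congr_arg (T.adj.homEquiv _ _) (h ((T.adj.homEquiv _ _).symm k))
  simpa only [Adjunction.homEquiv_naturality_right, Equiv.apply_symm_apply] using this

lemma algebra_hasColimits [HasColimits K] [PreservesColimits (T : K ⥤ K)] :
    HasColimits T.Algebra :=
  hasColimits_of_hasColimits_createsColimits T.forget

end AlgebraGenerators

section AlgebraGrothendieck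

variable {K : Type u} [Category.{v} K] [Abelian K] [IsGrothendieckAbelian.{v} K] (T : Monad K)
  [PreservesColimits (T : K ⥤ K)] [Abelian T.Algebra]

lemma algebra_isGrothendieckAbelian : IsGrothendieckAbelian.{v} T.Algebra := by
  have := algebra_hasColimits T
  have : HasFilteredColimitsOfSize.{v, v} T.Algebra := ⟨fun J _ _ => inferInstance⟩
  have : PreservesLimitsOfSize.{v, v} T.forget := inferInstance
  refine {
    ab5OfSize := ⟨fun J _ _ => HasExactColimitsOfShape.domain_of_functor J T.forget⟩
    hasSeparator := ?_ }
  obtain ⟨G, hG⟩ := HasSeparator.hasSeparator (C := K)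
  exact ⟨_, isSeparator_free T hG⟩

end AlgebraGrothendieck

section ImagesOfCoproducts

variable {K : Type u} [Category.{v} K] [Abelian K]

lemma imageSubobject_epi_comp {X Y Z : K} (e : X ⟶ Y) [Epi e] (f : Y ⟶ Z) :
    imageSubobject (e ≫ f) = imageSubobject f :=
  eq_of_forall_ge_iff fun N => by
    rw [imageSubobject_le_iff_factors, imageSubobject_le_iff_factors]
    exact ⟨factors_of_epi_comp N e f, Subobject.factors_of_factors_right e⟩

variable [IsGrothendieckAbelian.{v} K]

lemma iSup_eq_imageSubobject {X : K} {σ : Type v} (N : σ → Subobject X) :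
    ⨆ i, N i = imageSubobject (Sigma.desc fun i => (N i).arrow) :=
  eq_of_forall_ge_iff fun M => by
    rw [imageSubobject_le_iff_factors, iSup_le_iff]
    constructor
    · intro h
      refine factors_of_isColimit (colimit.isColimit _) _ M fun ⟨i⟩ => ?_
      have : M.Factors (N i).arrow := Subobject.factors_of_le _ (h i)
        (by simpa using factors_comp_arrow (𝟙 (N i : K)))
      simpa using this
    · intro h i
      have := mk_le_of_factors (N i).arrow (N := M) (by
        simpa using Subobject.factors_of_factors_right
          (Sigma.ι (fun i => (N i : K)) i) h)
      rwa [Subobject.mk_arrow] at this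

end ImagesOfCoproducts

section MapSub

variable {E : Type u'} [Category.{v} E] {K : Type u} [Category.{v} K] (U : E ⥤ K)
  [PreservesFiniteLimits U]

/-- The image of a subobject under a left exact functor. -/
noncomputable def mapSub {X : E} (N : Subobject X) : Subobject (U.obj X) :=
  Subobject.mk (U.map N.arrow)

lemma mapSub_mono {X : E} {N N' : Subobject X} (h : N ≤ N') : mapSub U N ≤ mapSub U N' :=
  Subobject.mk_le_mk_of_comm (U.map (Subobject.ofLE _ _ h))
    (by rw [← U.map_comp, Subobject.ofLE_arrow])

lemma mapSub_mk {X Y : E} (i : Y ⟶ X) [Mono i] :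
    mapSub U (Subobject.mk i) = Subobject.mk (U.map i) :=
  Subobject.mk_eq_mk_of_comm _ _ (U.mapIso (Subobject.underlyingIso i)) (by
    rw [Functor.mapIso_hom, ← U.map_comp, Subobject.underlyingIso_hom_comp_eq_mk])

lemma mapSub_top (X : E) : mapSub U (⊤ : Subobject X) = ⊤ :=
  (Subobject.isIso_iff_mk_eq_top (U.map (⊤ : Subobject X).arrow)).1 inferInstance

lemma eq_top_of_mapSub_eq_top [U.ReflectsIsomorphisms] {X : E} {N : Subobject X}
    (h : mapSub U N = ⊤) : N = ⊤ := by
  have := (Subobject.isIso_iff_mk_eq_top (U.map N.arrow)).2 h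
  have := isIso_of_reflects_iso N.arrow U
  exact Subobject.eq_top_of_isIso_arrow N

variable [Abelian E] [Abelian K] [U.Additive] [PreservesFiniteColimits U]

lemma IsQuotient.mapSub {X : E} {N N' : Subobject X} {s : E} (h : IsQuotient N N' s) :
    IsQuotient (mapSub U N) (CellularPaper.mapSub U N') (U.obj s) := by
  obtain ⟨e⟩ := (isQuotient_iff h.1 _).1 h
  refine (isQuotient_mk_iff _ _ (U.map (Subobject.ofLE _ _ h.1))
    (by rw [← U.map_comp, Subobject.ofLE_arrow]) _).2 ⟨?_⟩
  exact (PreservesCokernel.iso U _).symm ≪≫ U.mapIso e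

lemma mapSub_imageSubobject {X Y : E} (f : Y ⟶ X) :
    mapSub U (imageSubobject f) = imageSubobject (U.map f) := by
  conv_rhs => rw [← imageSubobject_arrow_comp f, U.map_comp, imageSubobject_epi_comp,
    imageSubobject_mono]
  rfl

variable [IsGrothendieckAbelian.{v} E] [IsGrothendieckAbelian.{v} K] [PreservesColimits U]

lemma mapSub_iSup {X : E} {σ : Type v} (N : σ → Subobject X) :
    mapSub U (⨆ i, N i) = ⨆ i, mapSub U (N i) := by
  apply le_antisymm
  · rw [iSup_eq_imageSubobject, mapSub_imageSubobject, imageSubobject_le_iff_factors]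
    refine factors_of_isColimit (isColimitOfPreserves U (colimit.isColimit _)) _ _ fun ⟨i⟩ => ?_
    have : (⨆ i, mapSub U (N i)).Factors (U.map (N i).arrow) :=
      Subobject.factors_of_le _ (le_iSup (fun i => mapSub U (N i)) i) (mk_factors_self _)
    simpa [← U.map_comp] using this
  · exact iSup_le fun i => mapSub_mono U (le_iSup N i)

lemma mapSub_partialSup {X : E} {J : Type v} (N : J → Subobject X) (I : Set J) :
    mapSub U (partialSup N I) = partialSup (fun j => mapSub U (N j)) I := by
  rw [partialSup, partialSup, iSup_subtype', iSup_subtype', mapSub_iSup]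

lemma hasFiltration_map {S : Set E} {S' : Set K} (hS : ∀ s ∈ S, U.obj s ∈ S') {X : E}
    (h : HasFiltration S (⊥ : Subobject X) ⊤) :
    HasFiltration S' (⊥ : Subobject (U.obj X)) ⊤ := by
  obtain ⟨J, i₁, i₂, A, hA, hA'⟩ := h
  simp only [bot_sup_eq] at hA hA'
  refine ⟨J, i₁, i₂, fun j => mapSub U (A j), ?_, fun j => ?_⟩
  · rw [bot_sup_eq, ← mapSub_iSup, hA, mapSub_top]
  · obtain ⟨s, hs, h⟩ := hA' j
    rw [bot_sup_eq, bot_sup_eq, ← mapSub_partialSup, ← mapSub_partialSup]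
    exact ⟨_, hS s hs, h.mapSub U⟩

end MapSub

section Subalgebras

variable {K : Type u} [Category.{v} K] [Abelian K] {T : Monad K}

/-- The image of the action of `T` on a subobject of an algebra. -/
noncomputable def actionSub (A : T.Algebra) (z : Subobject A.A) : Subobject A.A :=
  imageSubobject ((T : K ⥤ K).map z.arrow ≫ A.a)

/-- A subobject closed under the action is a subalgebra. -/
lemma exists_hom_of_actionSub_le {A : T.Algebra} {z : Subobject A.A} (h : actionSub A z ≤ z) :
    ∃ (B : T.Algebra) (f : B ⟶ A) (_ : Mono f.f), Subobject.mk f.f = z := by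
  obtain hz := (imageSubobject_le_iff_factors _ _).1 h
  let a : (T : K ⥤ K).obj z ⟶ z := z.factorThru _ hz
  have ha : a ≫ z.arrow = (T : K ⥤ K).map z.arrow ≫ A.a := Subobject.factorThru_arrow _ _ _
  let B : T.Algebra :=
    { A := z
      a := a
      unit := by
        rw [← cancel_mono z.arrow, assoc, ha]
        have := T.η.naturality z.arrow
        dsimp at this
        rw [← reassoc_of% this, A.unit, comp_id]
        exact (id_comp _).symm
      assoc := by
        rw [← cancel_mono z.arrow, assoc, ha, assoc, ha]
        have := T.μ.naturality z.arrow
        dsimp at this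
        rw [← reassoc_of% this, A.assoc, ← Functor.map_comp_assoc, ← ha,
          Functor.map_comp, assoc, ha] }
  exact ⟨B, ⟨z.arrow, ha.symm⟩, inferInstanceAs (Mono z.arrow), Subobject.mk_arrow z⟩

variable [PreservesColimits (T : K ⥤ K)]

lemma actionSub_imageSubobject (A : T.Algebra) {Y : K} (f : Y ⟶ A.A) :
    actionSub A (imageSubobject f) = imageSubobject ((T : K ⥤ K).map f ≫ A.a) := by
  have : PreservesFiniteColimits (T : K ⥤ K) := PreservesColimits.preservesFiniteColimits _
  conv_rhs => rw [← imageSubobject_arrow_comp f, Functor.map_comp, assoc, imageSubobject_epi_comp]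
  rfl

variable [IsGrothendieckAbelian.{v} K]

lemma actionSub_iSup_le (A : T.Algebra) {σ : Type v} (N : σ → Subobject A.A) :
    actionSub A (⨆ i, N i) ≤ ⨆ i, actionSub A (N i) := by
  rw [iSup_eq_imageSubobject, actionSub_imageSubobject, imageSubobject_le_iff_factors]
  refine factors_of_isColimit
    (isColimitOfPreserves (T : K ⥤ K) (colimit.isColimit _)) _ _ fun ⟨i⟩ => ?_
  have : (⨆ i, actionSub A (N i)).Factors ((T : K ⥤ K).map (N i).arrow ≫ A.a) :=
    Subobject.factors_of_le _ (le_iSup (fun i => actionSub A (N i)) i)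
      ((imageSubobject_le_iff_factors _ _).1 le_rfl)
  simpa [← Functor.map_comp_assoc] using this

lemma isSmallElement_actionSub {κ : Cardinal.{v}} (hκ : κ.IsRegular)
    (hκ' : Cardinal.aleph0 < κ) {G : K}
    (hG : Cardinal.mk (Shrink.{v} (Subobject ((T : K ⥤ K).obj G))) < κ) {A : T.Algebra}
    {a : Subobject A.A} (ha : IsGeneratedLT κ G a) : IsSmallElement κ (actionSub A a) := by
  obtain ⟨D, hD, rfl⟩ := ha
  rw [iSup_subtype']
  refine IsSmallElement.mono ?_ (actionSub_iSup_le A _)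
  refine IsSmallElement.iSup hκ hκ' (upperContinuous_subobject _) hD fun g => ?_
  rw [actionSub_imageSubobject]
  exact isSmallElement_imageSubobject _ hG

end Subalgebras

section Deconstructibility

lemma exists_subobject_iso_cokernel {K : Type u} [Category.{v} K] [Abelian K] {X Y : K}
    (r : X ⟶ Y) [Epi r] : ∃ N : Subobject X, Nonempty (cokernel N.arrow ≅ Y) :=
  ⟨Subobject.mk (kernel.ι r),
    ⟨cokernelIsoOfEq (Subobject.underlyingIso_hom_comp_eq_mk _).symm ≪≫ cokernelEpiComp _ _ ≪≫
      (colimit.isColimit _).coconePointUniqueUpToIso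
        (Abelian.epiIsCokernelOfKernel _ (limit.isLimit _))⟩⟩

lemma exists_epi_free {K : Type u} [Category.{v} K] {T : Monad K} {X : K} {B : T.Algebra}
    (q : X ⟶ T.forget.obj B) [Epi q] : ∃ r : T.free.obj X ⟶ B, Epi r := by
  let r : T.free.obj X ⟶ B := (T.adj.homEquiv _ _).symm q
  have hr : T.adj.unit.app X ≫ T.forget.map r = q :=
    (T.adj.homEquiv_unit _ _ _).symm.trans ((T.adj.homEquiv _ _).apply_symm_apply q)
  have : Epi (T.forget.map r) := epi_of_epi_fac hr
  exact ⟨r, T.forget.epi_of_epi_map this⟩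

variable {K : Type u} [Category.{v} K] [Abelian K] [IsGrothendieckAbelian.{v} K] (T : Monad K)
  [PreservesColimits (T : K ⥤ K)] [Abelian T.Algebra]

lemma deconstructible_algebra {C : Set K} (hC : Deconstructible C) :
    Deconstructible {A : T.Algebra | T.forget.obj A ∈ C} := by
  obtain ⟨ι, s, rfl⟩ := hC
  obtain ⟨G, hG⟩ := HasSeparator.hasSeparator (C := K)
  have := algebra_isGrothendieckAbelian T
  have : PreservesColimits T.forget := inferInstance
  have : PreservesFiniteColimits T.forget := PreservesColimits.preservesFiniteColimits _
  have : PreservesFiniteLimits T.forget := inferInstance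
  have : T.forget.Additive := additive_of_preservesColimits T.forget
  let F (i : ι) : Type v := Shrink.{v} (Subobject (s i))
  let P : Type v := Shrink.{v} (Subobject G) ⊕ Shrink.{v} (Subobject ((T : K ⥤ K).obj G)) ⊕
    (Σ i, F i)
  let κ : Cardinal.{v} := Order.succ (max Cardinal.aleph0 (Cardinal.mk P))
  have hκ : κ.IsRegular := Cardinal.isRegular_succ (le_max_left _ _)
  have hκ' : Cardinal.aleph0 < κ := Order.lt_succ_iff.2 (le_max_left _ _)
  have hlt {Q : Type v} (f : Q ↪ P) : Cardinal.mk Q < κ :=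
    Order.lt_succ_iff.2 ((Cardinal.mk_le_of_injective f.injective).trans (le_max_right _ _))
  have h1 : Cardinal.mk (Shrink.{v} (Subobject G)) < κ := hlt .inl
  have h2 : Cardinal.mk (Shrink.{v} (Subobject ((T : K ⥤ K).obj G))) < κ :=
    hlt (Function.Embedding.inl.trans .inr)
  have h3 : ∀ t ∈ Set.range s, Cardinal.mk (Shrink.{v} (Subobject t)) < κ := by
    rintro _ ⟨i, rfl⟩
    exact hlt ((Function.Embedding.sigmaMk (β := F) i).trans (Function.Embedding.inr.trans .inr))
  let D : T.Algebra := T.free.obj (∐ fun _ : κ.out => G)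
  let t (n : Shrink.{v} (Subobject D)) : T.Algebra := cokernel ((equivShrink _).symm n).arrow
  refine ⟨{n // T.forget.obj (t n) ∈ filteredBy (Set.range s)}, fun n => t n, Set.ext fun A => ?_⟩
  constructor
  · intro hA
    obtain ⟨J, i₁, i₂, B, hB, hB₁, hB₂, hB₃⟩ := exists_closed_filtration hκ hκ' hG h1 h3 hA
      (actionSub A) (actionSub_iSup_le A) fun a ha => isSmallElement_actionSub hκ hκ' h2 ha
    have (j : J) : ∃ N : Subobject A, mapSub T.forget N = B j := by
      obtain ⟨Z, f, hf, h⟩ := exists_hom_of_actionSub_le (hB₂ j)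
      have : Mono f := T.forget.mono_of_mono_map hf
      exact ⟨Subobject.mk f, (mapSub_mk T.forget f).trans h⟩
    choose N hN using this
    obtain rfl : (fun j => mapSub T.forget (N j)) = B := funext hN
    refine mem_filteredBy_of_hasFiltration ⟨J, i₁, i₂, N, ?_, fun j => ?_⟩
    · rw [bot_sup_eq]
      exact eq_top_of_mapSub_eq_top T.forget (by rw [mapSub_iSup, hB])
    · rw [bot_sup_eq, bot_sup_eq]
      obtain ⟨Q, hQ⟩ := exists_isQuotient (partialSup_mono N (Set.Iio_subset_Iic_self (a := j)))
      obtain ⟨t₀, ht₀, ht₀'⟩ := hB₃ j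
      rw [← mapSub_partialSup, ← mapSub_partialSup] at ht₀'
      obtain ⟨e⟩ := ht₀'.nonempty_iso (hQ.mapSub T.forget)
      obtain ⟨q, hq⟩ := (hB₁ j).exists_epi (Cardinal.mk_out κ).ge
      let u : (mapSub T.forget (N j) : K) ≅ T.forget.obj (N j) := Subobject.underlyingIso _
      have hu : Epi (q ≫ u.hom) := epi_comp' hq inferInstance
      obtain ⟨r, hr⟩ := exists_epi_free (q ≫ u.hom)
      have hQ' := hQ
      rw [partialSup_Iic, isQuotient_sup_iff] at hQ'
      obtain ⟨-, p, hp, -⟩ := hQ'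
      obtain ⟨M, ⟨e'⟩⟩ := exists_subobject_iso_cokernel (r ≫ p)
      obtain ⟨n, rfl⟩ := (equivShrink (Subobject D)).symm.surjective M
      exact ⟨t n, ⟨⟨n, mem_filteredBy_of_iso (e ≪≫ (T.forget.mapIso e').symm) ht₀⟩, rfl⟩,
        hQ.of_iso e'.symm⟩
  · intro hA
    refine mem_filteredBy_of_hasFiltration (hasFiltration_of_filteredBy
      (hasFiltration_map T.forget ?_ (hasFiltration_of_mem_filteredBy hA)))
    rintro _ ⟨n, rfl⟩
    exact n.2

end Deconstructibility

/-- if `T` is a colimit-preserving monad on a Grothendieck abelian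
category `K` and `C` is deconstructible in `K`, then `Alg(T)` is again (Grothendieck)
abelian and `{A : U A ∈ C}` is deconstructible in `Alg(T)`. -/
theorem monad_algebras_deconstructible {K : Type u} [Category.{v} K] [Abelian K]
    [HasColimits K] [HasFilteredColimits K] [AB5 K]
    (hgen : ∃ G : K, IsSeparator G)
    (T : Monad K) [PreservesColimits (T : K ⥤ K)]
    (C : Set K) (hC : Deconstructible C) :
    ∃ _inst : Abelian T.Algebra,
      HasColimits T.Algebra ∧ (∃ G : T.Algebra, IsSeparator G) ∧
      Deconstructible {A : T.Algebra | (Monad.forget T).obj A ∈ C} := by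
  obtain ⟨G, hG⟩ := hgen
  have : IsGrothendieckAbelian.{v} K := { hasSeparator := ⟨G, hG⟩ }
  have : (T : K ⥤ K).Additive := additive_of_preservesColimits _
  have : PreservesFiniteColimits (T : K ⥤ K) := PreservesColimits.preservesFiniteColimits _
  let inst : Abelian T.Algebra := algebraAbelian T
  exact ⟨inst, algebra_hasColimits T, ⟨_, isSeparator_free T hG⟩, deconstructible_algebra T hC⟩

end CellularPaper
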